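/- There exist universal constants a > 0 and ρ₀ ∈ (0,1) such that the following noise-operator form of hypercontractivity holds. Let (X,Π) be a two-sided γ-local-spectral expander with γ ≤ 2^{−a·k}, and let f ∈ C_k be an (ε,i)-pseudorandom function of degree i (i.e., its lifted Bottom-Up level functions f_j^↑ vanish for all j > i). Then: ‖T_{ρ₀} f‖₄⁴ ≤ ε·‖f‖₂²·‖f‖_∞². -/

import Mathlib

open Finset

/-- Functions on faces of a complex on vertex set `Fin n`. -/
abbrev Cf (n : ℕ) := Finset (Fin n) → ℝ

/-- A `d`-dimensional weighted pure simplicial complex on vertex set `Fin n`: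
the downward closure of a `d`-uniform hypergraph `faces d`, together with a
probability distribution on the top faces inducing distributions `w i` on each
level `faces i` via `π_i(x) = (1/(i+1))·Σ_{y ⊃ x} π_{i+1}(y)`. -/
structure WSC (n d : ℕ) where
  faces : ℕ → Finset (Finset (Fin n))
  top_nonempty : (faces d).Nonempty
  card_mem : ∀ i, ∀ s ∈ faces i, s.card = i
  empty_levels : ∀ i, d < i → faces i = ∅
  downward : ∀ i, i < d → ∀ s : Finset (Fin n),
    s ∈ faces i ↔ (s.card = i ∧ ∃ t ∈ faces (i+1), s ⊆ t)
  w : ℕ → Finset (Fin n) → ℝ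
  w_nonneg : ∀ i s, 0 ≤ w i s
  w_pos : ∀ i, ∀ s ∈ faces i, 0 < w i s
  w_zero : ∀ i s, s ∉ faces i → w i s = 0
  w_top_sum : ∑ s ∈ faces d, w d s = 1
  w_rec : ∀ i, i < d → ∀ s ∈ faces i,
    w i s = (1/(i+1 : ℝ)) * ∑ t ∈ (faces (i+1)).filter (fun t => s ⊆ t), w (i+1) t

variable {n d : ℕ}

/-- The up operator `U_k : C_k → C_{k+1}`. -/
noncomputable def Uop (X : WSC n d) (k : ℕ) (f : Cf n) : Cf n := fun τ =>
  (1/(k+1 : ℝ)) * ∑ σ ∈ (X.faces k).filter (fun σ => σ ⊆ τ), f σ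

/-- The down operator `D_{k+1} : C_{k+1} → C_k`. -/
noncomputable def Dop (X : WSC n d) (k : ℕ) (f : Cf n) : Cf n := fun τ =>
  (∑ σ ∈ (X.faces (k+1)).filter (fun σ => τ ⊆ σ), X.w (k+1) σ * f σ) /
  (∑ σ ∈ (X.faces (k+1)).filter (fun σ => τ ⊆ σ), X.w (k+1) σ)

/-- `Uc X i m : C_i → C_{i+m}` is the iterated up operator; `U_i^k = Uc X i (k-i)`. -/
noncomputable def Uc (X : WSC n d) (i : ℕ) : ℕ → Cf n → Cf n
  | 0, f => f
  | m+1, f => Uop X (i+m) (Uc X i m f)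

/-- `Dc X k m : C_k → C_{k-m}` is the iterated down operator; `D_i^k = Dc X k (k-i)`. -/
noncomputable def Dc (X : WSC n d) (k : ℕ) : ℕ → Cf n → Cf n
  | 0, f => f
  | m+1, f => Dop X (k - (m+1)) (Dc X k m f)

/-- Bottom-Up level functions: `g_i = D_i^k f − Σ_{j<i} C(i,j)·U_j^i g_j ∈ C_i`. -/
noncomputable def gLevel (X : WSC n d) (k : ℕ) (f : Cf n) : ℕ → Cf n
  | i => Dc X k (k - i) f - ∑ j ∈ (Finset.range i).attach,
      ((i.choose j.1 : ℝ)) • Uc X j.1 (i - j.1) (gLevel X k f j.1)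
  termination_by i => i
  decreasing_by exact Finset.mem_range.mp j.2

/-- Lifted Bottom-Up level functions: `f_i^↑ = C(k,i)·U_i^k g_i ∈ C_k`. -/
noncomputable def fLevel (X : WSC n d) (k : ℕ) (f : Cf n) (i : ℕ) : Cf n :=
  ((k.choose i : ℝ)) • Uc X i (k - i) (gLevel X k f i)

/-- Inner product at level `i`: `⟨f,g⟩ = E_{τ∼π_i}[f(τ)g(τ)]`. -/
noncomputable def ip (X : WSC n d) (i : ℕ) (f g : Cf n) : ℝ :=
  ∑ τ ∈ X.faces i, X.w i τ * f τ * g τ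

/-- Expectation at level `i`. -/
noncomputable def EE (X : WSC n d) (i : ℕ) (f : Cf n) : ℝ :=
  ∑ τ ∈ X.faces i, X.w i τ * f τ

/-- `L²` norm at level `i`. -/
noncomputable def norm2 (X : WSC n d) (i : ℕ) (f : Cf n) : ℝ := Real.sqrt (ip X i f f)

/-- `L^p` norm at level `i`. -/
noncomputable def normP (X : WSC n d) (i : ℕ) (p : ℝ) (f : Cf n) : ℝ :=
  (∑ τ ∈ X.faces i, X.w i τ * |f τ| ^ p) ^ (1/p)

/-- `L^∞` norm at level `i` : the maximum of `|f|` over `i`-faces. -/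
noncomputable def normInf (X : WSC n d) (i : ℕ) (f : Cf n) : ℝ :=
  ⨆ τ : {σ // σ ∈ X.faces i}, |f τ.1|

/-- `E_{X_τ}[f|_τ]`: the weighted mean of `f ∈ C_k` over `k`-faces containing `τ`. -/
noncomputable def linkMean (X : WSC n d) (k : ℕ) (τ : Finset (Fin n)) (f : Cf n) : ℝ :=
  (∑ ρ ∈ (X.faces k).filter (fun ρ => τ ⊆ ρ), X.w k ρ * f ρ) /
  (∑ ρ ∈ (X.faces k).filter (fun ρ => τ ⊆ ρ), X.w k ρ)

/-- `⟨f|_τ, g|_τ⟩` over the link `X_τ` with its induced distribution, for `f, g ∈ C_k`. -/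
noncomputable def linkIp (X : WSC n d) (k : ℕ) (τ : Finset (Fin n)) (f g : Cf n) : ℝ :=
  (∑ ρ ∈ (X.faces k).filter (fun ρ => τ ⊆ ρ), X.w k ρ * f ρ * g ρ) /
  (∑ ρ ∈ (X.faces k).filter (fun ρ => τ ⊆ ρ), X.w k ρ)

/-- `f ∈ C_k` is `(ε,i)`-pseudorandom: `|E_{X_τ}[f|_τ]| ≤ ε‖f‖_∞` and
`⟨f|_τ,f|_τ⟩ ≤ ε‖f‖_∞²` for every `i`-face `τ`. -/
def Pseudorandom (X : WSC n d) (k : ℕ) (ε : ℝ) (i : ℕ) (f : Cf n) : Prop :=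
  ∀ τ ∈ X.faces i, |linkMean X k τ f| ≤ ε * normInf X k f ∧
    linkIp X k τ f f ≤ ε * (normInf X k f)^2

/-- Boolean ({0,1}-valued) function on `X(k)`. -/
def IsBool (X : WSC n d) (k : ℕ) (f : Cf n) : Prop := ∀ τ ∈ X.faces k, f τ = 0 ∨ f τ = 1

/-- Total influence `I[f] = ⟨f, k(Id − U_{k−1}D_k) f⟩`. -/
noncomputable def influence (X : WSC n d) (k : ℕ) (f : Cf n) : ℝ :=
  (k : ℝ) * (ip X k f f - ip X k f (Uop X (k-1) (Dop X (k-1) f)))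

/-- Variance `Var(f) = E[f²] − E[f]²`. -/
noncomputable def variance (X : WSC n d) (k : ℕ) (f : Cf n) : ℝ :=
  ip X k f f - (EE X k f)^2

/-- The noise operator `T_ρ = Σ_{i=0}^k C(k,i)(1−ρ)^i ρ^{k−i} U_{k−i}^k D_{k−i}^k`. -/
noncomputable def noiseOp (X : WSC n d) (k : ℕ) (ρ : ℝ) (f : Cf n) : Cf n :=
  ∑ i ∈ Finset.range (k+1),
    ((k.choose i : ℝ) * (1-ρ)^i * ρ^(k-i)) • Uc X (k-i) i (Dc X k i f)

/-- Noise stability `Stab_ρ(f) = ⟨f, T_ρ f⟩`. -/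
noncomputable def stab (X : WSC n d) (k : ℕ) (ρ : ℝ) (f : Cf n) : ℝ :=
  ip X k f (noiseOp X k ρ f)

/-- Edge weights of the underlying graph of the link of `s ∈ X(i)`. -/
noncomputable def edgeW (X : WSC n d) (i : ℕ) (s : Finset (Fin n)) (u v : Fin n) : ℝ :=
  if u ≠ v ∧ u ∉ s ∧ v ∉ s ∧ insert u (insert v s) ∈ X.faces (i+2)
  then X.w (i+2) (insert u (insert v s)) else 0

/-- Vertex weights of the underlying graph of the link of `s ∈ X(i)`. -/
noncomputable def vertW (X : WSC n d) (i : ℕ) (s : Finset (Fin n)) (u : Fin n) : ℝ :=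
  ∑ v, edgeW X i s u v

/-- `X` is a two-sided `γ`-local-spectral expander: for every `i ≤ d−2` and every
`s ∈ X(i)` (including `s = ∅`), every nontrivial eigenvalue of the weighted adjacency
operator of the graph `(X_s(1), X_s(2))` has absolute value at most `γ`, expressed via
the quadratic form on functions orthogonal to constants. -/
def IsLSE (X : WSC n d) (γ : ℝ) : Prop :=
  ∀ i, i + 2 ≤ d → ∀ s ∈ X.faces i, ∀ f : Fin n → ℝ,
    (∑ u, vertW X i s u * f u) = 0 →
    |∑ u, ∑ v, edgeW X i s u v * f u * f v| ≤ γ * ∑ u, vertW X i s u * (f u)^2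

/-- The swap walk `S_{j,i} : C_i → C_j`: `(S_{j,i} f)(τ)` is the weighted mean of `f(σ)`
over `i`-faces `σ` disjoint from `τ` with `τ ∪ σ ∈ X(i+j)`. -/
noncomputable def swapW (X : WSC n d) (j i : ℕ) (f : Cf n) : Cf n := fun τ =>
  (∑ σ ∈ (X.faces i).filter (fun σ => Disjoint σ τ ∧ σ ∪ τ ∈ X.faces (i+j)),
      X.w (i+j) (σ ∪ τ) * f σ) /
  (∑ σ ∈ (X.faces i).filter (fun σ => Disjoint σ τ ∧ σ ∪ τ ∈ X.faces (i+j)),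
      X.w (i+j) (σ ∪ τ))

/-- Localized mean: `E_{σ ∼ π_{v,i}}[f(σ)]`, the mean of `f ∈ C_i` over the `i`-faces of
the link `X_v` of `v ∈ X(j)`, with respect to the distribution induced by the link. -/
noncomputable def locMean (X : WSC n d) (i j : ℕ) (v : Finset (Fin n)) (f : Cf n) : ℝ :=
  (∑ σ ∈ (X.faces i).filter (fun σ => Disjoint σ v ∧ σ ∪ v ∈ X.faces (i+j)),
      X.w (i+j) (σ ∪ v) * f σ) /
  (∑ σ ∈ (X.faces i).filter (fun σ => Disjoint σ v ∧ σ ∪ v ∈ X.faces (i+j)),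
      X.w (i+j) (σ ∪ v))

/-- The `m`-faces of the link `X_τ`. -/
noncomputable def lkFaces (X : WSC n d) (τ : Finset (Fin n)) (m : ℕ) : Finset (Finset (Fin n)) :=
  (Finset.univ : Finset (Finset (Fin n))).filter
    (fun σ => Disjoint σ τ ∧ σ ∪ τ ∈ X.faces (τ.card + m))

/-- Inner product at level `m` of the link `X_τ` (with the induced distribution). -/
noncomputable def lkIp (X : WSC n d) (τ : Finset (Fin n)) (m : ℕ) (f g : Cf n) : ℝ :=
  (∑ σ ∈ lkFaces X τ m, X.w (τ.card + m) (σ ∪ τ) * f σ * g σ) /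
  (∑ σ ∈ lkFaces X τ m, X.w (τ.card + m) (σ ∪ τ))

/-- `L²` norm at level `m` of the link `X_τ`. -/
noncomputable def lkNorm2 (X : WSC n d) (τ : Finset (Fin n)) (m : ℕ) (f : Cf n) : ℝ :=
  Real.sqrt (lkIp X τ m f f)

/-- Global mean at level `m` of the link `X_τ` (the stationary operator `U_0^j D_0^m`
of the swap walk on `X_τ` applied to `f`). -/
noncomputable def lkMeanLvl (X : WSC n d) (τ : Finset (Fin n)) (m : ℕ) (f : Cf n) : ℝ :=
  (∑ σ ∈ lkFaces X τ m, X.w (τ.card + m) (σ ∪ τ) * f σ) /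
  (∑ σ ∈ lkFaces X τ m, X.w (τ.card + m) (σ ∪ τ))

/-- The swap walk `S_{j,m}` within the link `X_τ`. -/
noncomputable def lkSwap (X : WSC n d) (τ : Finset (Fin n)) (j m : ℕ) (f : Cf n) : Cf n := fun v =>
  (∑ σ ∈ (lkFaces X τ m).filter (fun σ => Disjoint σ v ∧ σ ∪ v ∈ lkFaces X τ (m+j)),
      X.w (τ.card + m + j) (σ ∪ v ∪ τ) * f σ) /
  (∑ σ ∈ (lkFaces X τ m).filter (fun σ => Disjoint σ v ∧ σ ∪ v ∈ lkFaces X τ (m+j)),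
      X.w (τ.card + m + j) (σ ∪ v ∪ τ))

/-- Restriction `f|_τ(σ) = f(τ ∪ σ)`. -/
def restrictF (τ : Finset (Fin n)) (f : Cf n) : Cf n := fun σ => f (τ ∪ σ)

/-- The Bottom-Up level function of the restriction `f|_υ` computed within the link
`X_υ` (via its explicit form): `g_ℓ^{(υ)}(I) = Σ_{T ⊆ I} (−1)^{|I∖T|}·E_{(X_υ)_T}[f|_υ]`. -/
noncomputable def gLink (X : WSC n d) (k : ℕ) (f : Cf n) (υ : Finset (Fin n)) : Cf n :=
  fun I => ∑ σ ∈ I.powerset, (-1:ℝ)^((I \ σ).card) * linkMean X k (υ ∪ σ) f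

section Combinatorics

variable {α V : Type*} [DecidableEq α] [AddCommGroup V] [Module ℝ V]

/-- The Möbius transform of a set function on the Boolean lattice. -/
def altSum (F : Finset α → V) (T : Finset α) : V :=
  ∑ R ∈ T.powerset, (-1 : ℝ) ^ (T \ R).card • F R

lemma altSum_insert (F : Finset α → V) {v : α} {T : Finset α} (hv : v ∉ T) :
    altSum F (insert v T) = altSum (fun R => F (insert v R)) T - altSum F T := by
  unfold altSum
  rw [sum_powerset_insert hv, add_comm, sub_eq_add_neg, ← sum_neg_distrib]
  congr 1
  · refine sum_congr rfl fun R hR => ?_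
    rw [mem_powerset] at hR
    rw [insert_sdiff_insert, sdiff_insert_of_notMem hv]
  · refine sum_congr rfl fun R hR => ?_
    rw [mem_powerset] at hR
    rw [insert_sdiff_of_notMem _ (fun h => hv (hR h)), card_insert_of_notMem (by simp [hv]),
      pow_succ]
    simp

lemma altSum_eq_zero (F : Finset α → V) {v : α} {T : Finset α} (hv : v ∈ T)
    (hF : ∀ R, F (insert v R) = F R) : altSum F T = 0 := by
  rw [← insert_erase hv, altSum_insert F (notMem_erase v T)]
  simp [hF]

lemma sum_altSum (F : Finset α → V) (S : Finset α) :
    ∑ T ∈ S.powerset, altSum F T = F S := by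
  induction S using Finset.induction_on generalizing F with
  | empty => simp [altSum]
  | insert v S hv ih =>
    rw [sum_powerset_insert hv, ← sum_add_distrib, ← ih (fun R => F (insert v R))]
    refine sum_congr rfl fun T hT => ?_
    rw [altSum_insert F (fun h => hv (mem_powerset.1 hT h))]
    abel

lemma sum_altSum_superset [Fintype α] (F : Finset α → V) (S : Finset α) :
    ∑ T ∈ univ.filter (S ⊆ ·), altSum F T =
      ∑ R ∈ S.powerset, (-1 : ℝ) ^ R.card • F Rᶜ := by
  have hF : ∀ R : Finset α, F Rᶜ = ∑ T, if Disjoint R T then altSum F T else 0 := by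
    intro R
    rw [← sum_altSum F Rᶜ, ← sum_filter]
    refine sum_congr ?_ fun _ _ => rfl
    ext T
    simp [subset_compl_iff_disjoint_left]
  simp_rw [hF, smul_sum]
  rw [sum_comm, sum_filter]
  refine sum_congr rfl fun T _ => ?_
  have h1 : ∀ R ∈ S.powerset, ((-1 : ℝ) ^ R.card • if Disjoint R T then altSum F T else 0)
      = if Disjoint R T then (-1 : ℝ) ^ R.card • altSum F T else 0 := by
    intro R _
    split_ifs <;> simp
  have h2 : S.powerset.filter (fun R => Disjoint R T) = (S \ T).powerset := by
    ext R
    simp [subset_sdiff]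
  rw [sum_congr rfl h1, ← sum_filter, h2, ← sum_smul]
  have h3 := congrArg (Int.cast : ℤ → ℝ) (sum_powerset_neg_one_pow_card (x := S \ T))
  push_cast at h3
  rw [h3]
  simp only [sdiff_eq_empty_iff_subset]
  split_ifs <;> simp

lemma sum_eq_sum_inter_sdiff [Fintype α] (W : Finset α) (F : Finset α → ℝ) :
    ∑ T, F T = ∑ A ∈ W.powerset, ∑ C ∈ Wᶜ.powerset, F (A ∪ C) := by
  rw [← sum_product']
  refine sum_nbij' (fun T => (T ∩ W, T \ W)) (fun p => p.1 ∪ p.2) ?_ ?_ ?_ ?_ ?_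
  · intro T _
    simp only [mem_product, mem_powerset]
    exact ⟨inter_subset_right, fun x hx => by simp at hx ⊢; exact hx.2⟩
  · simp
  · intro T _
    ext x
    simp
    tauto
  · rintro ⟨A, C⟩ h
    simp only [mem_product, mem_powerset] at h
    have hC : ∀ x ∈ C, x ∉ W := fun x hx => by simpa using h.2 hx
    ext x
    · simp only [mem_inter, mem_union]
      have := @h.1 x
      have := hC x
      tauto
    · simp only [mem_sdiff, mem_union]
      have := @h.1 x
      have := hC x
      tauto
  · intro T _
    congr 1
    ext x
    simp
    tauto

/-- Pairs of sets agreeing off `W` and jointly covering `W`: a Cauchy–Schwarz bound. -/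
lemma sq_sum_matched_pairs_le [Fintype α] (W : Finset α) (b : Finset α → ℝ) :
    (∑ T, ∑ T', if T \ W = T' \ W ∧ W ⊆ T ∪ T' then b T * b T' else 0) ^ 2 ≤
      4 ^ W.card * ∑ T, ∑ T', if W ⊆ T ∪ T' then b T ^ 2 * b T' ^ 2 else 0 := by
  have key : ∀ A ∈ W.powerset, ∀ C ∈ Wᶜ.powerset, ∀ A' ∈ W.powerset, ∀ C' ∈ Wᶜ.powerset,
      ((A ∪ C) \ W = C) ∧ ((A' ∪ C') \ W = C') ∧ (W ⊆ A ∪ C ∪ (A' ∪ C') ↔ W ⊆ A ∪ A') := by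
    intro A hA C hC A' hA' C' hC'
    simp only [mem_powerset] at hA hC hA' hC'
    have h1 : ∀ x ∈ C, x ∉ W := fun x hx => by simpa using hC hx
    have h2 : ∀ x ∈ C', x ∉ W := fun x hx => by simpa using hC' hx
    refine ⟨?_, ?_, ?_⟩
    · ext x
      have := @hA x; have := h1 x
      simp only [mem_sdiff, mem_union]; tauto
    · ext x
      have := @hA' x; have := h2 x
      simp only [mem_sdiff, mem_union]; tauto
    · refine ⟨fun h x hx => ?_, fun h x hx => ?_⟩
      · have := h hx; have := h1 x; have := h2 x
        simp only [mem_union] at *; tauto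
      · have := h hx
        simp only [mem_union] at *; tauto
  have hL : (∑ T, ∑ T', if T \ W = T' \ W ∧ W ⊆ T ∪ T' then b T * b T' else 0) =
      ∑ p ∈ W.powerset ×ˢ W.powerset,
        if W ⊆ p.1 ∪ p.2 then ∑ C ∈ Wᶜ.powerset, b (p.1 ∪ C) * b (p.2 ∪ C) else 0 := by
    rw [sum_eq_sum_inter_sdiff W, sum_product]
    refine sum_congr rfl fun A hA => ?_
    have : ∀ C ∈ Wᶜ.powerset, (∑ T', if (A ∪ C) \ W = T' \ W ∧ W ⊆ A ∪ C ∪ T'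
        then b (A ∪ C) * b T' else 0) = ∑ A' ∈ W.powerset,
        if W ⊆ A ∪ A' then b (A ∪ C) * b (A' ∪ C) else 0 := by
      intro C hC
      rw [sum_eq_sum_inter_sdiff W]
      refine sum_congr rfl fun A' hA' => ?_
      rw [sum_eq_single_of_mem C hC]
      · obtain ⟨h1, h2, h3⟩ := key A hA C hC A' hA' C hC
        simp only [h1, h2, h3, true_and]
      · intro C' hC' hne
        obtain ⟨h1, h2, h3⟩ := key A hA C hC A' hA' C' hC'
        rw [h1, h2, if_neg]
        exact fun h => hne h.1.symm
    rw [sum_congr rfl this, sum_comm]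
    refine sum_congr rfl fun A' hA' => ?_
    split_ifs <;> simp
  have hR : (∑ T, ∑ T', if W ⊆ T ∪ T' then b T ^ 2 * b T' ^ 2 else 0) =
      ∑ p ∈ W.powerset ×ˢ W.powerset,
        if W ⊆ p.1 ∪ p.2 then (∑ C ∈ Wᶜ.powerset, b (p.1 ∪ C) ^ 2) *
          ∑ C ∈ Wᶜ.powerset, b (p.2 ∪ C) ^ 2 else 0 := by
    rw [sum_eq_sum_inter_sdiff W, sum_product]
    refine sum_congr rfl fun A hA => ?_
    have : ∀ C ∈ Wᶜ.powerset, (∑ T', if W ⊆ A ∪ C ∪ T'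
        then b (A ∪ C) ^ 2 * b T' ^ 2 else 0) = ∑ A' ∈ W.powerset,
        if W ⊆ A ∪ A' then ∑ C' ∈ Wᶜ.powerset, b (A ∪ C) ^ 2 * b (A' ∪ C') ^ 2 else 0 := by
      intro C hC
      rw [sum_eq_sum_inter_sdiff W]
      refine sum_congr rfl fun A' hA' => ?_
      have h : ∀ C' ∈ Wᶜ.powerset, (if W ⊆ A ∪ C ∪ (A' ∪ C') then
          b (A ∪ C) ^ 2 * b (A' ∪ C') ^ 2 else 0) =
          if W ⊆ A ∪ A' then b (A ∪ C) ^ 2 * b (A' ∪ C') ^ 2 else 0 := fun C' hC' => by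
        simp only [(key A hA C hC A' hA' C' hC').2.2]
      rw [sum_congr rfl h]
      split_ifs <;> simp
    rw [sum_congr rfl this, sum_comm]
    refine sum_congr rfl fun A' hA' => ?_
    split_ifs
    · rw [sum_mul_sum]
    · simp
  rw [hL, hR]
  refine (sq_sum_le_card_mul_sum_sq).trans ?_
  have hcard : ((W.powerset ×ˢ W.powerset).card : ℝ) = 4 ^ W.card := by
    rw [card_product, card_powerset]
    push_cast
    rw [← mul_pow]
    norm_num
  rw [hcard]
  gcongr with p hp
  split_ifs
  · exact sum_mul_sq_le_sq_mul_sq _ _ _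
  · simp

end Combinatorics

/-- A finite probability space with a family of conditional expectations `P S`, indexed by sets
of coordinates, which are pairwise `γ`-close to commuting. -/
structure CondSystem (Ω : Type*) [Fintype Ω] (k : ℕ) (γ : ℝ) where
  μ : Ω → ℝ
  μ_nonneg : ∀ x, 0 ≤ μ x
  μ_sum : ∑ x, μ x = 1
  P : Finset (Fin k) → (Ω → ℝ) →ₗ[ℝ] (Ω → ℝ)
  P_univ : ∀ f, P univ f = f
  P_empty : ∀ f x, P ∅ f x = ∑ y, μ y * f y
  P_P_of_subset : ∀ S T f, S ⊆ T → P S (P T f) = P S f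
  P_P_of_superset : ∀ S T f, S ⊆ T → P T (P S f) = P S f
  P_mul : ∀ S f g, P S (P S f * g) = P S f * P S g
  P_one : ∀ S, P S 1 = 1
  P_nonneg : ∀ S f, 0 ≤ f → 0 ≤ P S f
  sum_P : ∀ S f, ∑ x, μ x * P S f x = ∑ x, μ x * f x
  γ_nonneg : 0 ≤ γ
  near : ∀ S i j f, i ∉ S → j ∉ S → i ≠ j →
    ∑ x, μ x * (P (insert i S) (P (insert j S) f) x - P S f x) ^ 2 ≤
      γ ^ 2 * ∑ x, μ x * f x ^ 2

namespace CondSystem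

variable {Ω : Type*} [Fintype Ω] {k : ℕ} {γ : ℝ} (C : CondSystem Ω k γ)

/-- Expectation. -/
def E : (Ω → ℝ) →ₗ[ℝ] ℝ where
  toFun f := ∑ x, C.μ x * f x
  map_add' f g := by simp [mul_add, sum_add_distrib]
  map_smul' c f := by simp [mul_sum, mul_left_comm]

lemma E_apply (f : Ω → ℝ) : C.E f = ∑ x, C.μ x * f x := rfl

lemma E_mono {f g : Ω → ℝ} (h : f ≤ g) : C.E f ≤ C.E g :=
  sum_le_sum fun x _ => mul_le_mul_of_nonneg_left (h x) (C.μ_nonneg x)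

lemma E_nonneg {f : Ω → ℝ} (h : 0 ≤ f) : 0 ≤ C.E f := by
  simpa using C.E_mono h

lemma E_const (c : ℝ) : C.E (fun _ => c) = c := by
  simp [E_apply, ← sum_mul, C.μ_sum]

lemma E_P (S : Finset (Fin k)) (f : Ω → ℝ) : C.E (C.P S f) = C.E f := C.sum_P S f

lemma E_P_mul (S : Finset (Fin k)) (f g : Ω → ℝ) :
    C.E (C.P S f * g) = C.E (C.P S f * C.P S g) := by
  rw [← C.E_P S (C.P S f * g), C.P_mul]

lemma E_P_mul_comm (S : Finset (Fin k)) (f g : Ω → ℝ) :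
    C.E (C.P S f * g) = C.E (f * C.P S g) := by
  rw [C.E_P_mul, mul_comm f, C.E_P_mul S g f, mul_comm]

lemma P_mono (S : Finset (Fin k)) {f g : Ω → ℝ} (h : f ≤ g) : C.P S f ≤ C.P S g := by
  have := C.P_nonneg S (g - f) (sub_nonneg.2 h)
  rwa [map_sub, sub_nonneg] at this

lemma P_const (S : Finset (Fin k)) (c : ℝ) : C.P S (fun _ => c) = fun _ => c := by
  have h : (fun _ => c : Ω → ℝ) = c • 1 := by ext; simp
  rw [h, map_smul, C.P_one]

lemma P_le_const (S : Finset (Fin k)) {f : Ω → ℝ} {c : ℝ} (h : ∀ x, f x ≤ c) (x : Ω) :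
    C.P S f x ≤ c := by
  have := C.P_mono S (g := fun _ => c) h x
  rwa [P_const] at this

lemma abs_P_le (S : Finset (Fin k)) {f : Ω → ℝ} {B : ℝ} (h : ∀ x, |f x| ≤ B) (x : Ω) :
    |C.P S f x| ≤ B := by
  rw [abs_le]
  constructor
  · have := C.P_le_const S (f := -f) (c := B) (fun x => (neg_le_abs _).trans (h x)) x
    rw [map_neg, Pi.neg_apply] at this
    linarith
  · exact C.P_le_const S (fun x => (le_abs_self _).trans (h x)) x

/-- Conditional Cauchy–Schwarz. -/
lemma sq_P_mul_le (S : Finset (Fin k)) (f g : Ω → ℝ) (x : Ω) :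
    C.P S (f * g) x ^ 2 ≤ C.P S (f ^ 2) x * C.P S (g ^ 2) x := by
  have h : ∀ t : ℝ, 0 ≤ C.P S (g ^ 2) x * (t * t) + (2 * C.P S (f * g) x) * t
      + C.P S (f ^ 2) x := by
    intro t
    have h0 := C.P_nonneg S ((f + t • g) ^ 2) (fun y => sq_nonneg _) x
    have h1 : (f + t • g) ^ 2 = f ^ 2 + (2 * t) • (f * g) + (t * t) • g ^ 2 := by
      ext y
      simp
      ring
    rw [h1] at h0
    simp only [map_add, map_smul, Pi.add_apply, Pi.smul_apply, smul_eq_mul, Pi.zero_apply] at h0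
    linarith
  have := discrim_le_zero h
  rw [discrim] at this
  linarith

lemma sq_P_le (S : Finset (Fin k)) (f : Ω → ℝ) (x : Ω) :
    C.P S f x ^ 2 ≤ C.P S (f ^ 2) x := by
  simpa [C.P_one] using C.sq_P_mul_le S f 1 x

/-- The `L²` norm. -/
noncomputable def nrm (f : Ω → ℝ) : ℝ := √(C.E (f ^ 2))

lemma nrm_nonneg (f : Ω → ℝ) : 0 ≤ C.nrm f := Real.sqrt_nonneg _

lemma nrm_sq (f : Ω → ℝ) : C.nrm f ^ 2 = C.E (f ^ 2) :=
  Real.sq_sqrt (C.E_nonneg fun _ => sq_nonneg _)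

lemma abs_E_mul_le (f g : Ω → ℝ) : |C.E (f * g)| ≤ C.nrm f * C.nrm g := by
  refine abs_le_of_sq_le_sq ?_ (mul_nonneg (C.nrm_nonneg f) (C.nrm_nonneg g))
  rw [mul_pow, nrm_sq, nrm_sq]
  have h := sum_mul_sq_le_sq_mul_sq univ (fun x => √(C.μ x) * f x) (fun x => √(C.μ x) * g x)
  have h1 : ∀ x, √(C.μ x) * √(C.μ x) = C.μ x := fun x => Real.mul_self_sqrt (C.μ_nonneg x)
  simp only [E_apply]
  convert h using 2
  · refine sum_congr rfl fun x _ => ?_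
    rw [Pi.mul_apply]; linear_combination (-(f x * g x)) * h1 x
  · refine sum_congr rfl fun x _ => ?_
    rw [Pi.pow_apply]; linear_combination (-(f x ^ 2)) * h1 x
  · refine sum_congr rfl fun x _ => ?_
    rw [Pi.pow_apply]; linear_combination (-(g x ^ 2)) * h1 x

lemma E_mul_le (f g : Ω → ℝ) : C.E (f * g) ≤ C.nrm f * C.nrm g :=
  (le_abs_self _).trans (C.abs_E_mul_le f g)

lemma nrm_le_of_sq_le {f : Ω → ℝ} {B : ℝ} (hB : 0 ≤ B) (h : C.E (f ^ 2) ≤ B ^ 2) :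
    C.nrm f ≤ B := by
  rw [← Real.sqrt_sq hB]
  exact Real.sqrt_le_sqrt h

lemma nrm_add_le (f g : Ω → ℝ) : C.nrm (f + g) ≤ C.nrm f + C.nrm g := by
  refine C.nrm_le_of_sq_le (add_nonneg (C.nrm_nonneg f) (C.nrm_nonneg g)) ?_
  have h : (f + g) ^ 2 = f ^ 2 + (2 : ℝ) • (f * g) + g ^ 2 := by
    ext x
    simp
    ring
  rw [h, map_add, map_add, map_smul, ← nrm_sq, ← nrm_sq, smul_eq_mul]
  nlinarith [C.E_mul_le f g]

lemma nrm_smul (c : ℝ) (f : Ω → ℝ) : C.nrm (c • f) = |c| * C.nrm f := by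
  rw [nrm, smul_pow, map_smul, smul_eq_mul, Real.sqrt_mul (sq_nonneg c), Real.sqrt_sq_eq_abs, nrm]

lemma nrm_sum_le {ι : Type*} (s : Finset ι) (F : ι → Ω → ℝ) :
    C.nrm (∑ i ∈ s, F i) ≤ ∑ i ∈ s, C.nrm (F i) := by
  classical
  induction s using Finset.induction_on with
  | empty => simp [nrm]
  | insert a s ha ih =>
    rw [sum_insert ha, sum_insert ha]
    exact (C.nrm_add_le _ _).trans (by gcongr)

lemma nrm_mono {f g : Ω → ℝ} (h : ∀ x, |f x| ≤ |g x|) : C.nrm f ≤ C.nrm g :=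
  Real.sqrt_le_sqrt (C.E_mono fun x => sq_le_sq.2 (h x))

lemma nrm_mul_le {f : Ω → ℝ} {B : ℝ} (hf : ∀ x, |f x| ≤ B) (g : Ω → ℝ) :
    C.nrm (f * g) ≤ B * C.nrm g := by
  rcases isEmpty_or_nonempty Ω with hΩ | ⟨⟨x₀⟩⟩
  · simp [nrm, E_apply]
  have hB : 0 ≤ B := (abs_nonneg _).trans (hf x₀)
  rw [← abs_of_nonneg hB, ← nrm_smul]
  refine C.nrm_mono fun x => ?_
  simp only [Pi.mul_apply, Pi.smul_apply, smul_eq_mul, abs_mul]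
  rw [abs_of_nonneg hB]
  exact mul_le_mul_of_nonneg_right (hf x) (abs_nonneg _)

lemma nrm_P_le (S : Finset (Fin k)) (f : Ω → ℝ) : C.nrm (C.P S f) ≤ C.nrm f := by
  refine Real.sqrt_le_sqrt ?_
  rw [← C.E_P S (f ^ 2)]
  exact C.E_mono fun x => C.sq_P_le S f x

lemma nrm_P_insert_sub_le (T : Finset (Fin k)) {i j : Fin k} (hi : i ∉ T) (hj : j ∉ T)
    (hij : i ≠ j) (f : Ω → ℝ) :
    C.nrm (C.P (insert i T) (C.P (insert j T) f) - C.P T f) ≤ γ * C.nrm f := by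
  refine C.nrm_le_of_sq_le (mul_nonneg C.γ_nonneg (C.nrm_nonneg f)) ?_
  rw [mul_pow, nrm_sq]
  exact C.near T i j f hi hj hij

lemma nrm_P_superset_P_insert_sub_le (T R : Finset (Fin k)) {j : Fin k} (hT : j ∉ T) (hR : j ∉ R)
    (f : Ω → ℝ) :
    C.nrm (C.P (R ∪ T) (C.P (insert j T) f) - C.P T f) ≤ R.card * γ * C.nrm f := by
  induction R using Finset.induction_on with
  | empty => simp [C.P_P_of_subset _ _ _ (subset_insert j T), nrm]
  | insert i R hi ih =>
    rw [mem_insert, not_or] at hR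
    have ih := ih hR.2
    rw [card_insert_of_notMem hi]
    push_cast
    by_cases hiT : i ∈ T
    · rw [insert_union, insert_eq_self.2 (mem_union_right _ hiT)]
      nlinarith [mul_nonneg C.γ_nonneg (C.nrm_nonneg f)]
    have hA : i ∉ R ∪ T := by simp [hi, hiT]
    have hB : j ∉ R ∪ T := by simp [hR.2, hT]
    have h1 := C.nrm_P_insert_sub_le (R ∪ T) hA hB (Ne.symm hR.1) (C.P (insert j T) f)
    rw [C.P_P_of_superset _ _ _ (insert_subset_insert j subset_union_right)] at h1
    have h2 := h1.trans (mul_le_mul_of_nonneg_left (C.nrm_P_le _ _) C.γ_nonneg)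
    rw [insert_union]
    calc _ = C.nrm ((C.P (insert i (R ∪ T)) (C.P (insert j T) f)
            - C.P (R ∪ T) (C.P (insert j T) f))
          + (C.P (R ∪ T) (C.P (insert j T) f) - C.P T f)) := by
          congr 1; abel
      _ ≤ _ := C.nrm_add_le _ _
      _ ≤ γ * C.nrm f + R.card * γ * C.nrm f := add_le_add h2 ih
      _ = _ := by ring

lemma nrm_P_P_union_sub_le (S T R : Finset (Fin k)) (hT : T ⊆ S) (hR : Disjoint R S)
    (f : Ω → ℝ) :
    C.nrm (C.P S (C.P (R ∪ T) f) - C.P T f) ≤ R.card * S.card * γ * C.nrm f := by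
  induction R using Finset.induction_on with
  | empty => simp [C.P_P_of_superset _ _ _ hT, nrm]
  | insert j R hj ih =>
    rw [disjoint_insert_left] at hR
    have ih := ih hR.2
    rw [card_insert_of_notMem hj]
    push_cast
    have hjT : j ∉ R ∪ T := by
      simp only [mem_union, not_or]
      exact ⟨hj, fun h => hR.1 (hT h)⟩
    have h1 := C.nrm_P_superset_P_insert_sub_le (R ∪ T) S hjT hR.1 f
    have h2 : C.P S (C.P (insert j (R ∪ T)) f) - C.P S (C.P (R ∪ T) f) =
        C.P S (C.P (S ∪ (R ∪ T)) (C.P (insert j (R ∪ T)) f) - C.P (R ∪ T) f) := by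
      rw [map_sub, C.P_P_of_subset S (S ∪ (R ∪ T)) _ subset_union_left]
    have h3 := (C.nrm_P_le S (C.P (S ∪ (R ∪ T)) (C.P (insert j (R ∪ T)) f)
      - C.P (R ∪ T) f)).trans h1
    rw [← h2] at h3
    rw [insert_union]
    calc _ = C.nrm ((C.P S (C.P (insert j (R ∪ T)) f) - C.P S (C.P (R ∪ T) f))
          + (C.P S (C.P (R ∪ T) f) - C.P T f)) := by
          congr 1; abel
      _ ≤ _ := C.nrm_add_le _ _
      _ ≤ S.card * γ * C.nrm f + R.card * S.card * γ * C.nrm f := add_le_add h3 ih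
      _ = _ := by ring

/-- Conditional expectations approximately compose by intersecting their index sets. -/
lemma nrm_P_P_sub_le (S T : Finset (Fin k)) (f : Ω → ℝ) :
    C.nrm (C.P S (C.P T f) - C.P (S ∩ T) f) ≤ (2 ^ k) ^ 2 * γ * C.nrm f := by
  have h := C.nrm_P_P_union_sub_le S (S ∩ T) (T \ S) inter_subset_left sdiff_disjoint f
  have h1 : T \ S ∪ S ∩ T = T := by
    rw [inter_comm]; exact sdiff_union_inter T S
  rw [h1] at h
  refine h.trans ?_
  have hc : ∀ A : Finset (Fin k), (A.card : ℝ) ≤ 2 ^ k := fun A => by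
    have h2 : A.card ≤ 2 ^ k := (card_le_univ A).trans (by simpa using Nat.lt_two_pow_self.le)
    exact_mod_cast h2
  have := C.γ_nonneg
  have := C.nrm_nonneg f
  gcongr
  rw [sq]
  exact mul_le_mul (hc _) (hc _) (by positivity) (by positivity)

lemma abs_E_mul_P_P_sub_le (S T : Finset (Fin k)) (f g : Ω → ℝ) :
    |C.E (g * C.P S (C.P T f)) - C.E (g * C.P (S ∩ T) f)| ≤
      (2 ^ k) ^ 2 * γ * (C.nrm g * C.nrm f) := by
  rw [← map_sub, ← mul_sub]
  refine (C.abs_E_mul_le _ _).trans ?_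
  calc _ ≤ C.nrm g * ((2 ^ k) ^ 2 * γ * C.nrm f) :=
        mul_le_mul_of_nonneg_left (C.nrm_P_P_sub_le S T f) (C.nrm_nonneg g)
    _ = _ := by ring

end CondSystem

namespace CondSystem

variable {Ω : Type*} [Fintype Ω] {k : ℕ} {γ : ℝ} (C : CondSystem Ω k γ)

/-- The component of `f` on the coordinates `T` (an approximate Efron–Stein decomposition). -/
def comp (f : Ω → ℝ) (T : Finset (Fin k)) : Ω → ℝ := altSum (fun R => C.P R f) T

lemma comp_apply (f : Ω → ℝ) (T : Finset (Fin k)) (x : Ω) :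
    C.comp f T x = altSum (fun R => C.P R f x) T := by
  simp [comp, altSum, Finset.sum_apply]

lemma card_powerset_le (T : Finset (Fin k)) : (T.powerset.card : ℝ) ≤ 2 ^ k := by
  rw [card_powerset]
  push_cast
  exact pow_le_pow_right₀ one_le_two (by simpa using card_le_univ T)

lemma card_univ_eq : ((univ : Finset (Finset (Fin k))).card : ℝ) = 2 ^ k := by
  simp

lemma abs_comp_le_of_card_le {f : Ω → ℝ} {i : ℕ} {B : ℝ} {T : Finset (Fin k)} (hT : T.card ≤ i)
    (x : Ω) (h : ∀ S : Finset (Fin k), S.card ≤ i → |C.P S f x| ≤ B) :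
    |C.comp f T x| ≤ 2 ^ T.card * B := by
  rw [comp_apply, altSum]
  refine (abs_sum_le_sum_abs _ _).trans ?_
  rw [← Nat.cast_ofNat, ← Nat.cast_pow, ← card_powerset, ← nsmul_eq_mul]
  refine sum_le_card_nsmul _ _ _ fun R hR => ?_
  rw [smul_eq_mul, abs_mul, abs_neg_one_pow, one_mul]
  exact h R ((card_le_card (mem_powerset.1 hR)).trans hT)

lemma abs_comp_le {f : Ω → ℝ} {M : ℝ} (hf : ∀ x, |f x| ≤ M) (T : Finset (Fin k)) (x : Ω) :
    |C.comp f T x| ≤ 2 ^ k * M := by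
  refine (C.abs_comp_le_of_card_le le_rfl x fun S _ => C.abs_P_le S hf x).trans ?_
  have : 0 ≤ M := (abs_nonneg _).trans (hf x)
  gcongr
  · exact one_le_two
  · simpa using card_le_univ T

lemma nrm_altSum_le (F : Finset (Fin k) → Ω → ℝ) (T : Finset (Fin k)) {B : ℝ} (hB : 0 ≤ B)
    (h : ∀ R, C.nrm (F R) ≤ B) : C.nrm (altSum F T) ≤ 2 ^ k * B := by
  refine (C.nrm_sum_le _ _).trans ?_
  calc _ ≤ T.powerset.card • B := sum_le_card_nsmul _ _ _ fun R _ => by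
        rw [nrm_smul, abs_neg_one_pow, one_mul]; exact h R
    _ ≤ 2 ^ k * B := by
        rw [nsmul_eq_mul]; exact mul_le_mul_of_nonneg_right (card_powerset_le T) hB

lemma nrm_comp_le (f : Ω → ℝ) (T : Finset (Fin k)) : C.nrm (C.comp f T) ≤ 2 ^ k * C.nrm f :=
  C.nrm_altSum_le _ T (C.nrm_nonneg f) fun R => C.nrm_P_le R f

lemma P_altSum (S : Finset (Fin k)) (F : Finset (Fin k) → Ω → ℝ) (T : Finset (Fin k)) :
    C.P S (altSum F T) = altSum (fun R => C.P S (F R)) T := by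
  simp [altSum, map_sum]

lemma P_comp_of_subset (f : Ω → ℝ) {T S : Finset (Fin k)} (h : T ⊆ S) :
    C.P S (C.comp f T) = C.comp f T := by
  rw [comp, P_altSum]
  refine sum_congr rfl fun R hR => ?_
  simp only [C.P_P_of_superset R S f ((mem_powerset.1 hR).trans h)]

lemma nrm_P_comp_le (f : Ω → ℝ) {T S : Finset (Fin k)} (h : ¬ T ⊆ S) :
    C.nrm (C.P S (C.comp f T)) ≤ (2 ^ k) ^ 3 * γ * C.nrm f := by
  obtain ⟨v, hv, hvS⟩ := not_subset.1 h
  have h0 : altSum (fun R => C.P (S ∩ R) f) T = 0 :=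
    altSum_eq_zero _ hv fun R => by rw [inter_insert_of_notMem hvS]
  have h1 : C.P S (C.comp f T) = altSum (fun R => C.P S (C.P R f) - C.P (S ∩ R) f) T := by
    rw [comp, P_altSum, ← sub_zero (altSum (fun R => C.P S (C.P R f)) T), ← h0]
    simp [altSum, smul_sub]
  rw [h1]
  have := C.γ_nonneg
  have := C.nrm_nonneg f
  refine (C.nrm_altSum_le _ T (B := (2 ^ k) ^ 2 * γ * C.nrm f) (by positivity)
    fun R => C.nrm_P_P_sub_le S R f).trans (le_of_eq (by ring))

lemma P_mul_of_eq {S : Finset (Fin k)} {a b : Ω → ℝ} (ha : C.P S a = a) (hb : C.P S b = b) :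
    C.P S (a * b) = a * b := by
  have := C.P_mul S a b
  rwa [ha, hb] at this

lemma abs_E_comp_mul_le (f : Ω → ℝ) {T S : Finset (Fin k)} (h : ¬ T ⊆ S) {u : Ω → ℝ}
    (hu : C.P S u = u) :
    |C.E (C.comp f T * u)| ≤ (2 ^ k) ^ 3 * γ * C.nrm f * C.nrm u := by
  rw [← hu, ← C.E_P_mul_comm, hu]
  refine (C.abs_E_mul_le _ _).trans ?_
  exact mul_le_mul_of_nonneg_right (C.nrm_P_comp_le f h) (C.nrm_nonneg u)

lemma nrm_comp_mul_comp_le {f : Ω → ℝ} {M : ℝ} (hM : 0 ≤ M) (hf : ∀ x, |f x| ≤ M)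
    (T T' : Finset (Fin k)) :
    C.nrm (C.comp f T * C.comp f T') ≤ (2 ^ k) ^ 2 * (M * C.nrm f) := by
  refine (C.nrm_mul_le (C.abs_comp_le hf T) _).trans ?_
  calc _ ≤ 2 ^ k * M * (2 ^ k * C.nrm f) := by
        gcongr; exact C.nrm_comp_le f T'
    _ = _ := by ring

lemma abs_E_comp_four_le {f : Ω → ℝ} {M : ℝ} (hM : 0 ≤ M) (hf : ∀ x, |f x| ≤ M)
    {T₁ T₂ T₃ T₄ : Finset (Fin k)} (h : ¬ T₁ ⊆ T₂ ∪ T₃ ∪ T₄) :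
    |C.E (C.comp f T₁ * (C.comp f T₂ * (C.comp f T₃ * C.comp f T₄)))| ≤
      (2 ^ k) ^ 6 * γ * M ^ 2 * C.nrm f ^ 2 := by
  have hP : C.P (T₂ ∪ T₃ ∪ T₄) (C.comp f T₂ * (C.comp f T₃ * C.comp f T₄)) =
      C.comp f T₂ * (C.comp f T₃ * C.comp f T₄) := by
    refine C.P_mul_of_eq (C.P_comp_of_subset f ?_) (C.P_mul_of_eq (C.P_comp_of_subset f ?_)
      (C.P_comp_of_subset f ?_)) <;> intro x hx <;> simp [hx]
  have hγ := C.γ_nonneg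
  have hN := C.nrm_nonneg f
  refine (C.abs_E_comp_mul_le f h hP).trans ?_
  calc _ ≤ (2 ^ k) ^ 3 * γ * C.nrm f * (2 ^ k * M * ((2 ^ k) ^ 2 * (M * C.nrm f))) := by
        gcongr
        refine (C.nrm_mul_le (C.abs_comp_le hf T₂) _).trans ?_
        gcongr
        exact C.nrm_comp_mul_comp_le hM hf T₃ T₄
    _ = _ := by ring

/-- The conditional second moment of a component, as an `L²` size. -/
noncomputable def csize (f : Ω → ℝ) (W T : Finset (Fin k)) (x : Ω) : ℝ :=
  √(C.P W (C.comp f T ^ 2) x)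

lemma P_sq_nonneg (S : Finset (Fin k)) (a : Ω → ℝ) (x : Ω) : 0 ≤ C.P S (a ^ 2) x :=
  C.P_nonneg S _ (fun _ => sq_nonneg _) x

lemma abs_P_mul_le_csize (f : Ω → ℝ) (W T T' : Finset (Fin k)) (x : Ω) :
    |C.P W (C.comp f T * C.comp f T') x| ≤ C.csize f W T x * C.csize f W T' x := by
  rw [csize, csize, ← Real.sqrt_mul (C.P_sq_nonneg W _ x), ← Real.sqrt_sq_eq_abs]
  exact Real.sqrt_le_sqrt (C.sq_P_mul_le W _ _ x)

lemma E_comp_four_le {f : Ω → ℝ} {M : ℝ} (hM : 0 ≤ M) (hf : ∀ x, |f x| ≤ M)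
    (T₁ T₂ T₃ T₄ : Finset (Fin k)) :
    |C.E (C.comp f T₁ * (C.comp f T₂ * (C.comp f T₃ * C.comp f T₄)))| ≤
      C.E (fun x => C.csize f ((T₁ ∪ T₂) ∩ (T₃ ∪ T₄)) T₁ x * C.csize f ((T₁ ∪ T₂) ∩ (T₃ ∪ T₄)) T₂ x
        * (C.csize f ((T₁ ∪ T₂) ∩ (T₃ ∪ T₄)) T₃ x * C.csize f ((T₁ ∪ T₂) ∩ (T₃ ∪ T₄)) T₄ x)) +
      (2 ^ k) ^ 6 * γ * M ^ 2 * C.nrm f ^ 2 := by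
  set W := (T₁ ∪ T₂) ∩ (T₃ ∪ T₄) with hW
  set a := C.comp f T₁ * C.comp f T₂ with ha
  set b := C.comp f T₃ * C.comp f T₄ with hb
  have hPa : C.P (T₁ ∪ T₂) a = a := C.P_mul_of_eq (C.P_comp_of_subset f subset_union_left)
    (C.P_comp_of_subset f subset_union_right)
  have hPb : C.P (T₃ ∪ T₄) b = b := C.P_mul_of_eq (C.P_comp_of_subset f subset_union_left)
    (C.P_comp_of_subset f subset_union_right)
  rw [← mul_assoc, ← ha]
  have h1 : C.E (a * b) = C.E (a * C.P (T₁ ∪ T₂) (C.P (T₃ ∪ T₄) b)) := by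
    rw [hPb, ← C.E_P_mul_comm, hPa]
  have h2 := C.abs_E_mul_P_P_sub_le (T₁ ∪ T₂) (T₃ ∪ T₄) b a
  rw [← h1, ← hW] at h2
  have h3 : C.E (a * C.P W b) = C.E (C.P W a * C.P W b) := by
    rw [← C.E_P_mul_comm, C.E_P_mul]
  have h4 : |C.E (C.P W a * C.P W b)| ≤ C.E (fun x => C.csize f W T₁ x * C.csize f W T₂ x
        * (C.csize f W T₃ x * C.csize f W T₄ x)) := by
    have h5 : ∀ x, |(C.P W a * C.P W b) x| ≤ C.csize f W T₁ x * C.csize f W T₂ x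
        * (C.csize f W T₃ x * C.csize f W T₄ x) := fun x => by
      rw [Pi.mul_apply, abs_mul]
      exact mul_le_mul (C.abs_P_mul_le_csize f W T₁ T₂ x) (C.abs_P_mul_le_csize f W T₃ T₄ x)
        (abs_nonneg _) (mul_nonneg (Real.sqrt_nonneg _) (Real.sqrt_nonneg _))
    rw [abs_le]
    constructor
    · rw [← map_neg]
      exact C.E_mono fun x => (abs_le.1 (h5 x)).1
    · exact C.E_mono fun x => (abs_le.1 (h5 x)).2
  have hγ := C.γ_nonneg
  have hN := C.nrm_nonneg f
  have h6 : (2 ^ k) ^ 2 * γ * (C.nrm a * C.nrm b) ≤ (2 ^ k) ^ 6 * γ * M ^ 2 * C.nrm f ^ 2 := by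
    calc _ ≤ (2 ^ k) ^ 2 * γ * (((2 ^ k) ^ 2 * (M * C.nrm f)) * ((2 ^ k) ^ 2 * (M * C.nrm f))) := by
          gcongr
          · exact C.nrm_nonneg b
          · exact C.nrm_comp_mul_comp_le hM hf _ _
          · exact C.nrm_comp_mul_comp_le hM hf _ _
      _ = _ := by ring
  rw [h3] at h2
  calc _ = |C.E (C.P W a * C.P W b) + (C.E (a * b) - C.E (C.P W a * C.P W b))| := by
        congr 1; ring
    _ ≤ _ := abs_add_le _ _
    _ ≤ _ := add_le_add h4 (h2.trans h6)

/-- The contribution of a pair of components agreeing off `W` and jointly covering `W`. -/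
noncomputable def pairTerm (f : Ω → ℝ) (c : Finset (Fin k) → ℝ) (W T T' : Finset (Fin k)) :
    Ω → ℝ := fun x =>
  if T \ W = T' \ W ∧ W ⊆ T ∪ T' then
    (|c T| * C.csize f W T x) * (|c T'| * C.csize f W T' x) else 0

lemma pairTerm_nonneg (f : Ω → ℝ) (c : Finset (Fin k) → ℝ) (W T T' : Finset (Fin k)) (x : Ω) :
    0 ≤ C.pairTerm f c W T T' x := by
  unfold pairTerm csize
  split_ifs <;> positivity

lemma E_four_le_sum_pairTerm {f : Ω → ℝ} {M : ℝ} (hM : 0 ≤ M) (hf : ∀ x, |f x| ≤ M)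
    {c : Finset (Fin k) → ℝ} (hc : ∀ T, |c T| ≤ 1) (T₁ T₂ T₃ T₄ : Finset (Fin k)) :
    c T₁ * c T₂ * (c T₃ * c T₄) *
        C.E (C.comp f T₁ * (C.comp f T₂ * (C.comp f T₃ * C.comp f T₄))) ≤
      ∑ W, C.E (C.pairTerm f c W T₁ T₂ * C.pairTerm f c W T₃ T₄) +
        (2 ^ k) ^ 6 * γ * M ^ 2 * C.nrm f ^ 2 := by
  have hγ := C.γ_nonneg
  have hN := C.nrm_nonneg f
  have hcc : |c T₁ * c T₂ * (c T₃ * c T₄)| ≤ 1 := by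
    simp only [abs_mul]
    have h12 := mul_le_one₀ (hc T₁) (abs_nonneg _) (hc T₂)
    have h34 := mul_le_one₀ (hc T₃) (abs_nonneg _) (hc T₄)
    exact mul_le_one₀ h12 (by positivity) h34
  have hnn : ∀ W, 0 ≤ C.E (C.pairTerm f c W T₁ T₂ * C.pairTerm f c W T₃ T₄) := fun W =>
    C.E_nonneg fun x => mul_nonneg (C.pairTerm_nonneg ..) (C.pairTerm_nonneg ..)
  refine (le_abs_self _).trans ?_
  rw [abs_mul]
  set X := C.E (C.comp f T₁ * (C.comp f T₂ * (C.comp f T₃ * C.comp f T₄))) with hX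
  have hsingle : |X| ≤ (2 ^ k) ^ 6 * γ * M ^ 2 * C.nrm f ^ 2 →
      |c T₁ * c T₂ * (c T₃ * c T₄)| * |X| ≤
      ∑ W, C.E (C.pairTerm f c W T₁ T₂ * C.pairTerm f c W T₃ T₄) +
        (2 ^ k) ^ 6 * γ * M ^ 2 * C.nrm f ^ 2 := fun h => by
    have h0 := sum_nonneg fun W (_ : W ∈ univ) => hnn W
    have h1 := mul_le_mul hcc h (abs_nonneg _) zero_le_one
    linarith
  by_cases h1 : T₁ ⊆ T₂ ∪ T₃ ∪ T₄
  swap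
  · exact hsingle (C.abs_E_comp_four_le hM hf h1)
  by_cases h2 : T₂ ⊆ T₁ ∪ T₃ ∪ T₄
  swap
  · refine hsingle (le_trans (le_of_eq ?_) (C.abs_E_comp_four_le hM hf h2))
    rw [hX]; congr 2; ring
  by_cases h3 : T₃ ⊆ T₁ ∪ T₂ ∪ T₄
  swap
  · refine hsingle (le_trans (le_of_eq ?_) (C.abs_E_comp_four_le hM hf h3))
    rw [hX]; congr 2; ring
  by_cases h4 : T₄ ⊆ T₁ ∪ T₂ ∪ T₃
  swap
  · refine hsingle (le_trans (le_of_eq ?_) (C.abs_E_comp_four_le hM hf h4))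
    rw [hX]; congr 2; ring
  set W := (T₁ ∪ T₂) ∩ (T₃ ∪ T₄) with hW
  have hmain := C.E_comp_four_le hM hf T₁ T₂ T₃ T₄
  rw [← hX, ← hW] at hmain
  have hq : T₁ \ W = T₂ \ W ∧ W ⊆ T₁ ∪ T₂ := by
    refine ⟨?_, inter_subset_left⟩
    ext x
    have := @h1 x
    have := @h2 x
    simp only [hW, mem_sdiff, mem_inter, mem_union] at *
    tauto
  have hq' : T₃ \ W = T₄ \ W ∧ W ⊆ T₃ ∪ T₄ := by
    refine ⟨?_, inter_subset_right⟩
    ext x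
    have := @h3 x
    have := @h4 x
    simp only [hW, mem_sdiff, mem_inter, mem_union] at *
    tauto
  have hpt : C.pairTerm f c W T₁ T₂ * C.pairTerm f c W T₃ T₄ =
      |c T₁ * c T₂ * (c T₃ * c T₄)| • (fun x => C.csize f W T₁ x * C.csize f W T₂ x
        * (C.csize f W T₃ x * C.csize f W T₄ x)) := by
    ext x
    simp only [pairTerm, Pi.mul_apply, if_pos hq, if_pos hq', Pi.smul_apply, smul_eq_mul, abs_mul]
    ring
  have h5 := single_le_sum (fun W _ => hnn W) (mem_univ W)
  rw [hpt, map_smul, smul_eq_mul] at h5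
  calc _ ≤ |c T₁ * c T₂ * (c T₃ * c T₄)| * _ := mul_le_mul_of_nonneg_left hmain (abs_nonneg _)
    _ = _ := mul_add _ _ _
    _ ≤ _ := by
      refine add_le_add h5 ?_
      exact mul_le_of_le_one_left (by positivity) hcc

end CondSystem

namespace CondSystem

variable {Ω : Type*} [Fintype Ω] {k : ℕ} {γ : ℝ} (C : CondSystem Ω k γ)

lemma E_pow_four_le_sum_pairTerm {f : Ω → ℝ} {M : ℝ} (hM : 0 ≤ M) (hf : ∀ x, |f x| ≤ M)
    {c : Finset (Fin k) → ℝ} (hc : ∀ T, |c T| ≤ 1) :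
    C.E ((∑ T, c T • C.comp f T) ^ 4) ≤
      ∑ W, C.E ((∑ T, ∑ T', C.pairTerm f c W T T') ^ 2) +
        (2 ^ k) ^ 10 * γ * M ^ 2 * C.nrm f ^ 2 := by
  have hexp : C.E ((∑ T, c T • C.comp f T) ^ 4) = ∑ T₁, ∑ T₂, ∑ T₃, ∑ T₄,
      c T₁ * c T₂ * (c T₃ * c T₄) *
        C.E (C.comp f T₁ * (C.comp f T₂ * (C.comp f T₃ * C.comp f T₄))) := by
    have h : (∑ T, c T • C.comp f T) ^ 4 = (∑ T, c T • C.comp f T) * ((∑ T, c T • C.comp f T) *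
        ((∑ T, c T • C.comp f T) * (∑ T, c T • C.comp f T))) := by ring
    rw [h]
    simp only [mul_sum, map_sum, sum_mul]
    refine sum_congr rfl fun T₁ _ => sum_congr rfl fun T₂ _ => sum_congr rfl fun T₃ _ =>
      sum_congr rfl fun T₄ _ => ?_
    rw [← smul_eq_mul (c T₁ * c T₂ * (c T₃ * c T₄)), ← map_smul]
    congr 1
    ext x
    simp
    ring
  have hsum : ∑ W, C.E ((∑ T, ∑ T', C.pairTerm f c W T T') ^ 2) = ∑ T₁, ∑ T₂, ∑ T₃, ∑ T₄,
      ∑ W, C.E (C.pairTerm f c W T₁ T₂ * C.pairTerm f c W T₃ T₄) := by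
    have h : ∀ W, C.E ((∑ T, ∑ T', C.pairTerm f c W T T') ^ 2) = ∑ T₁, ∑ T₂, ∑ T₃, ∑ T₄,
        C.E (C.pairTerm f c W T₁ T₂ * C.pairTerm f c W T₃ T₄) := fun W => by
      simp only [sq, mul_sum, map_sum, sum_mul]
      exact sum_congr rfl fun T₁ _ => sum_congr rfl fun T₂ _ => sum_congr rfl fun T₃ _ =>
        sum_congr rfl fun T₄ _ => by rw [mul_comm]
    simp only [h]
    rw [sum_comm]
    refine sum_congr rfl fun T₁ _ => ?_
    rw [sum_comm]
    refine sum_congr rfl fun T₂ _ => ?_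
    rw [sum_comm]
    refine sum_congr rfl fun T₃ _ => ?_
    rw [sum_comm]
  rw [hexp, hsum]
  have h1 : (2 ^ k) ^ 10 * γ * M ^ 2 * C.nrm f ^ 2 =
      ∑ _T₁ : Finset (Fin k), ∑ _T₂ : Finset (Fin k), ∑ _T₃ : Finset (Fin k),
        ∑ _T₄ : Finset (Fin k), (2 ^ k) ^ 6 * γ * M ^ 2 * C.nrm f ^ 2 := by
    simp only [sum_const, nsmul_eq_mul, card_univ_eq]
    ring
  rw [h1]
  simp only [← sum_add_distrib]
  exact sum_le_sum fun T₁ _ => sum_le_sum fun T₂ _ => sum_le_sum fun T₃ _ =>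
    sum_le_sum fun T₄ _ => C.E_four_le_sum_pairTerm hM hf hc T₁ T₂ T₃ T₄

lemma E_P_sq_mul_P_sq_le {f : Ω → ℝ} {M : ℝ} (hM : 0 ≤ M) (hf : ∀ x, |f x| ≤ M)
    (W T T' : Finset (Fin k)) :
    C.E (C.P W (C.comp f T ^ 2) * C.P W (C.comp f T' ^ 2)) ≤
      C.E (C.P (T ∩ (W ∩ T')) (C.comp f T ^ 2) * C.P (T ∩ (W ∩ T')) (C.comp f T' ^ 2)) +
        2 * ((2 ^ k) ^ 6 * γ * M ^ 2 * C.nrm f ^ 2) := by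
  set a := C.comp f T ^ 2 with ha
  set b := C.comp f T' ^ 2 with hb
  have hPa : C.P T a = a := by
    rw [ha, sq]
    exact C.P_mul_of_eq (C.P_comp_of_subset f le_rfl) (C.P_comp_of_subset f le_rfl)
  have hPb : C.P T' b = b := by
    rw [hb, sq]
    exact C.P_mul_of_eq (C.P_comp_of_subset f le_rfl) (C.P_comp_of_subset f le_rfl)
  have hna : C.nrm a ≤ (2 ^ k) ^ 2 * (M * C.nrm f) := by
    rw [ha, sq]; exact C.nrm_comp_mul_comp_le hM hf T T
  have hnb : C.nrm b ≤ (2 ^ k) ^ 2 * (M * C.nrm f) := by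
    rw [hb, sq]; exact C.nrm_comp_mul_comp_le hM hf T' T'
  have h1 := C.abs_E_mul_P_P_sub_le W T' b a
  have h2 := C.abs_E_mul_P_P_sub_le T (W ∩ T') b a
  have e1 : ∀ S, C.E (C.P S a * C.P S b) = C.E (a * C.P S b) := fun S => by
    rw [← C.E_P_mul, C.E_P_mul_comm]
  have e2 : C.E (a * C.P T (C.P (W ∩ T') b)) = C.E (a * C.P (W ∩ T') b) := by
    rw [← C.E_P_mul_comm, hPa]
  rw [hPb] at h1
  rw [e2] at h2
  have hγ := C.γ_nonneg
  have hN := C.nrm_nonneg f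
  have h3 : (2 ^ k) ^ 2 * γ * (C.nrm a * C.nrm b) ≤ (2 ^ k) ^ 6 * γ * M ^ 2 * C.nrm f ^ 2 := by
    calc _ ≤ (2 ^ k) ^ 2 * γ * (((2 ^ k) ^ 2 * (M * C.nrm f)) * ((2 ^ k) ^ 2 * (M * C.nrm f))) := by
          gcongr
          exact C.nrm_nonneg b
      _ = _ := by ring
  rw [e1, e1]
  linarith [(abs_le.1 h1).2, (abs_le.1 h2).2]

/-- The weighted conditional energy of the components containing `S`. -/
def energy (f : Ω → ℝ) (w : Finset (Fin k) → ℝ) (S : Finset (Fin k)) : Ω → ℝ :=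
  ∑ T ∈ univ.filter (S ⊆ ·), w T • C.P S (C.comp f T ^ 2)

lemma E_sq_sum_pairTerm_le (f : Ω → ℝ) (c : Finset (Fin k) → ℝ) (W : Finset (Fin k)) :
    C.E ((∑ T, ∑ T', C.pairTerm f c W T T') ^ 2) ≤
      ∑ T, ∑ T', if W ⊆ T ∪ T' then 4 ^ W.card * (c T ^ 2 * c T' ^ 2 *
        C.E (C.P W (C.comp f T ^ 2) * C.P W (C.comp f T' ^ 2))) else 0 := by
  have hR : (∑ T, ∑ T', if W ⊆ T ∪ T' then 4 ^ W.card * (c T ^ 2 * c T' ^ 2 *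
        C.E (C.P W (C.comp f T ^ 2) * C.P W (C.comp f T' ^ 2))) else 0) =
      C.E (∑ T, ∑ T', if W ⊆ T ∪ T' then (4 ^ W.card * (c T ^ 2 * c T' ^ 2)) •
        (C.P W (C.comp f T ^ 2) * C.P W (C.comp f T' ^ 2)) else 0) := by
    simp only [map_sum]
    refine sum_congr rfl fun T _ => sum_congr rfl fun T' _ => ?_
    split_ifs
    · rw [map_smul, smul_eq_mul]; ring
    · simp
  rw [hR]
  refine C.E_mono fun x => ?_
  have h := sq_sum_matched_pairs_le W (fun T => |c T| * C.csize f W T x)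
  simp only [Pi.pow_apply, Finset.sum_apply, pairTerm]
  refine h.trans (le_of_eq ?_)
  rw [mul_sum]
  refine sum_congr rfl fun T _ => ?_
  rw [mul_sum]
  refine sum_congr rfl fun T' _ => ?_
  split_ifs
  · simp only [mul_pow, sq_abs, csize, Real.sq_sqrt (C.P_sq_nonneg W _ x), Pi.smul_apply,
      Pi.mul_apply, smul_eq_mul]
    ring
  · simp

lemma sum_E_sq_sum_pairTerm_le {f : Ω → ℝ} {M : ℝ} (hM : 0 ≤ M) (hf : ∀ x, |f x| ≤ M)
    {c : Finset (Fin k) → ℝ} (hc : ∀ T, |c T| ≤ (1 / 8) ^ T.card) :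
    ∑ W, C.E ((∑ T, ∑ T', C.pairTerm f c W T T') ^ 2) ≤
      ∑ S, C.E (C.energy f (fun T => c T ^ 2 * 8 ^ T.card) S ^ 2) +
        2 * ((2 ^ k) ^ 9 * γ * M ^ 2 * C.nrm f ^ 2) := by
  have hγ := C.γ_nonneg
  have hN := C.nrm_nonneg f
  set G : Finset (Fin k) → Finset (Fin k) → Finset (Fin k) → ℝ := fun S T T' =>
    C.E (C.P S (C.comp f T ^ 2) * C.P S (C.comp f T' ^ 2)) with hG
  have hGn : ∀ S T T', 0 ≤ G S T T' := fun S T T' =>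
    C.E_nonneg fun x => mul_nonneg (C.P_sq_nonneg S _ x) (C.P_sq_nonneg S _ x)
  set err := (2 ^ k) ^ 6 * γ * M ^ 2 * C.nrm f ^ 2 with herr
  have herr0 : 0 ≤ err := by positivity
  have hc2 : ∀ T, c T ^ 2 * 4 ^ T.card ≤ 1 := fun T => by
    have h1 : c T ^ 2 ≤ ((1 / 8) ^ T.card) ^ 2 := by
      rw [← sq_abs]
      exact pow_le_pow_left₀ (abs_nonneg _) (hc T) 2
    calc _ ≤ ((1 / 8) ^ T.card) ^ 2 * (4 : ℝ) ^ T.card := by gcongr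
      _ = (1 / 16) ^ T.card := by rw [← pow_mul, mul_comm T.card, pow_mul, ← mul_pow]; norm_num
      _ ≤ 1 := pow_le_one₀ (by norm_num) (by norm_num)
  have hterm : ∀ W T T' : Finset (Fin k), (if W ⊆ T ∪ T' then 4 ^ W.card * (c T ^ 2 * c T' ^ 2 * G W T T') else 0)
      ≤ (if W ⊆ T ∪ T' then (c T ^ 2 * 4 ^ T.card) * (c T' ^ 2 * 4 ^ T'.card) *
        ∑ S ∈ (T ∩ T').powerset, G S T T' else 0) + 2 * err := by
    intro W T T'
    split_ifs with h
    swap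
    · linarith
    have h4 : (4 : ℝ) ^ W.card ≤ 4 ^ T.card * 4 ^ T'.card := by
      rw [← pow_add]
      exact pow_le_pow_right₀ (by norm_num) ((card_le_card h).trans (card_union_le T T'))
    have hS : T ∩ (W ∩ T') ∈ (T ∩ T').powerset := by
      rw [mem_powerset]
      exact inter_subset_inter_left inter_subset_right
    have h5 := single_le_sum (f := fun S => G S T T') (fun S _ => hGn S T T') hS
    have h6 : G W T T' ≤ ∑ S ∈ (T ∩ T').powerset, G S T T' + 2 * err :=
      (C.E_P_sq_mul_P_sq_le hM hf W T T').trans (add_le_add h5 le_rfl)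
    have h7 : (c T ^ 2 * 4 ^ T.card) * (c T' ^ 2 * 4 ^ T'.card) ≤ 1 :=
      mul_le_one₀ (hc2 T) (by positivity) (hc2 T')
    calc _ ≤ (4 ^ T.card * 4 ^ T'.card) * (c T ^ 2 * c T' ^ 2 * G W T T') := by
          have := hGn W T T'
          gcongr
      _ = (c T ^ 2 * 4 ^ T.card) * (c T' ^ 2 * 4 ^ T'.card) * G W T T' := by ring
      _ ≤ (c T ^ 2 * 4 ^ T.card) * (c T' ^ 2 * 4 ^ T'.card) *
          (∑ S ∈ (T ∩ T').powerset, G S T T' + 2 * err) := by gcongr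
      _ ≤ _ := by
          rw [mul_add]
          have := mul_le_of_le_one_left (show 0 ≤ 2 * err by linarith) h7
          linarith
  have hW : ∀ T T' : Finset (Fin k), (∑ W : Finset (Fin k), if W ⊆ T ∪ T' then (c T ^ 2 * 4 ^ T.card) * (c T' ^ 2 * 4 ^ T'.card) *
        ∑ S ∈ (T ∩ T').powerset, G S T T' else 0) ≤
      (c T ^ 2 * 8 ^ T.card) * (c T' ^ 2 * 8 ^ T'.card) * ∑ S ∈ (T ∩ T').powerset, G S T T' := by
    intro T T'
    rw [← sum_filter, sum_const, nsmul_eq_mul]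
    have h1 : univ.filter (· ⊆ T ∪ T') = (T ∪ T').powerset := by
      ext A
      simp only [mem_filter, mem_univ, true_and, mem_powerset]
    have h2 : ((univ.filter (· ⊆ T ∪ T')).card : ℝ) ≤ 2 ^ T.card * 2 ^ T'.card := by
      rw [h1, card_powerset, ← pow_add]
      push_cast
      exact pow_le_pow_right₀ (by norm_num) (card_union_le T T')
    have h3 : 0 ≤ ∑ S ∈ (T ∩ T').powerset, G S T T' := sum_nonneg fun S _ => hGn S T T'
    calc _ ≤ (2 ^ T.card * 2 ^ T'.card) * ((c T ^ 2 * 4 ^ T.card) * (c T' ^ 2 * 4 ^ T'.card) *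
            ∑ S ∈ (T ∩ T').powerset, G S T T') := by gcongr
      _ = _ := by
          have h8 : ∀ m : ℕ, (8 : ℝ) ^ m = 2 ^ m * 4 ^ m := fun m => by
            rw [← mul_pow]; norm_num
          rw [h8, h8]
          ring
  have hS : ∑ T, ∑ T', (c T ^ 2 * 8 ^ T.card) * (c T' ^ 2 * 8 ^ T'.card) *
      ∑ S ∈ (T ∩ T').powerset, G S T T' =
      ∑ S, C.E (C.energy f (fun T => c T ^ 2 * 8 ^ T.card) S ^ 2) := by
    have h1 : ∀ S, C.E (C.energy f (fun T => c T ^ 2 * 8 ^ T.card) S ^ 2) =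
        ∑ T : Finset (Fin k), ∑ T' : Finset (Fin k), if S ⊆ T ∩ T' then
          (c T ^ 2 * 8 ^ T.card) * (c T' ^ 2 * 8 ^ T'.card) * G S T T' else 0 := by
      intro S
      rw [energy, sq, sum_mul_sum, map_sum, sum_filter]
      refine sum_congr rfl fun T _ => ?_
      rw [map_sum, sum_filter]
      split_ifs with hT
      · refine sum_congr rfl fun T' _ => ?_
        simp only [subset_inter_iff, hT, true_and]
        split_ifs
        · rw [smul_mul_smul_comm, map_smul, smul_eq_mul]
        · rfl
      · simp [subset_inter_iff, hT]
    symm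
    simp only [h1]
    rw [sum_comm]
    refine sum_congr rfl fun T _ => ?_
    rw [sum_comm]
    refine sum_congr rfl fun T' _ => ?_
    rw [mul_sum, ← sum_filter]
    refine sum_congr ?_ fun _ _ => rfl
    ext S
    simp only [mem_filter, mem_univ, true_and, mem_powerset]
  calc _ ≤ ∑ W : Finset (Fin k), ∑ T : Finset (Fin k), ∑ T' : Finset (Fin k), ((if W ⊆ T ∪ T' then (c T ^ 2 * 4 ^ T.card) *
        (c T' ^ 2 * 4 ^ T'.card) * ∑ S ∈ (T ∩ T').powerset, G S T T' else 0) + 2 * err) :=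
        sum_le_sum fun W _ => (C.E_sq_sum_pairTerm_le f c W).trans
          (sum_le_sum fun T _ => sum_le_sum fun T' _ => hterm W T T')
    _ = (∑ T : Finset (Fin k), ∑ T' : Finset (Fin k), ∑ W : Finset (Fin k), if W ⊆ T ∪ T' then (c T ^ 2 * 4 ^ T.card) *
        (c T' ^ 2 * 4 ^ T'.card) * ∑ S ∈ (T ∩ T').powerset, G S T T' else 0) +
        2 * ((2 ^ k) ^ 9 * γ * M ^ 2 * C.nrm f ^ 2) := by
        simp only [sum_add_distrib, sum_const, nsmul_eq_mul, card_univ_eq]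
        congr 1
        · rw [sum_comm]
          exact sum_congr rfl fun T _ => sum_comm
        · rw [herr]; ring
    _ ≤ _ := by
        rw [← hS]
        gcongr with T _ T' _
        exact hW T T'

end CondSystem

namespace CondSystem

variable {Ω : Type*} [Fintype Ω] {k : ℕ} {γ : ℝ} (C : CondSystem Ω k γ)

lemma one_le_two_pow : (1 : ℝ) ≤ 2 ^ k := one_le_pow₀ one_le_two

lemma abs_E_mul_comp_mul_comp_le {f Φ : Ω → ℝ} {B : ℝ} (hB : 0 ≤ B) {S T T' : Finset (Fin k)}
    (hΦ : C.P S Φ = Φ) (hΦB : ∀ x, |Φ x| ≤ B) (hT : S ⊆ T) (hT' : S ⊆ T') (hne : T ≠ T') :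
    |C.E (Φ * (C.comp f T * C.comp f T'))| ≤ B * (2 ^ k) ^ 4 * γ * C.nrm f ^ 2 := by
  have key : ∀ {T T' : Finset (Fin k)}, S ⊆ T' → ¬ T ⊆ T' →
      |C.E (Φ * (C.comp f T * C.comp f T'))| ≤ B * (2 ^ k) ^ 4 * γ * C.nrm f ^ 2 := by
    intro T T' hT' h
    have hγ := C.γ_nonneg
    have hN := C.nrm_nonneg f
    have hΦ' : C.P T' Φ = Φ := by
      rw [← hΦ]; exact C.P_P_of_superset _ _ _ hT'
    have h1 := C.abs_E_comp_mul_le f h (C.P_mul_of_eq hΦ' (C.P_comp_of_subset f le_rfl))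
    rw [mul_left_comm]
    refine h1.trans ?_
    calc _ ≤ (2 ^ k) ^ 3 * γ * C.nrm f * (B * (2 ^ k * C.nrm f)) := by
          gcongr
          refine (C.nrm_mul_le hΦB _).trans ?_
          gcongr
          exact C.nrm_comp_le f T'
      _ = _ := by ring
  by_cases h : T ⊆ T'
  · rw [mul_comm (C.comp f T)]
    exact key hT fun h' => hne (h.antisymm h')
  · exact key hT' h

lemma abs_E_mul_sq_sum_comp_sub_le {f Φ : Ω → ℝ} {B : ℝ} (hB : 0 ≤ B) {S : Finset (Fin k)}
    (hΦ : C.P S Φ = Φ) (hΦB : ∀ x, |Φ x| ≤ B) {A : Finset (Finset (Fin k))}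
    (hA : ∀ T ∈ A, S ⊆ T) {c : Finset (Fin k) → ℝ} (hc : ∀ T, |c T| ≤ 1) :
    |C.E (Φ * (∑ T ∈ A, c T • C.comp f T) ^ 2) - ∑ T ∈ A, c T ^ 2 * C.E (Φ * C.comp f T ^ 2)| ≤
      B * (2 ^ k) ^ 6 * γ * C.nrm f ^ 2 := by
  have hγ := C.γ_nonneg
  have hexp : C.E (Φ * (∑ T ∈ A, c T • C.comp f T) ^ 2) =
      ∑ T ∈ A, ∑ T' ∈ A, c T * c T' * C.E (Φ * (C.comp f T * C.comp f T')) := by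
    rw [sq, sum_mul_sum]
    simp only [mul_sum, map_sum]
    refine sum_congr rfl fun T _ => sum_congr rfl fun T' _ => ?_
    rw [← smul_eq_mul (c T * c T'), ← map_smul]
    congr 1
    ext x
    simp
    ring
  have hdiag : ∑ T ∈ A, c T ^ 2 * C.E (Φ * C.comp f T ^ 2) =
      ∑ T ∈ A, ∑ T' ∈ A, if T = T' then
        c T * c T' * C.E (Φ * (C.comp f T * C.comp f T')) else 0 := by
    refine sum_congr rfl fun T hT => ?_
    rw [sum_ite_eq, if_pos hT, sq, sq]
  rw [hexp, hdiag, ← sum_sub_distrib]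
  simp only [← sum_sub_distrib]
  set e := B * (2 ^ k) ^ 4 * γ * C.nrm f ^ 2 with he
  have he0 : 0 ≤ e := by positivity
  have hA' : (A.card : ℝ) ≤ 2 ^ k := by
    rw [← card_univ_eq]
    exact_mod_cast card_le_univ A
  have hterm : ∀ T ∈ A, ∀ T' ∈ A, |c T * c T' * C.E (Φ * (C.comp f T * C.comp f T')) -
      (if T = T' then c T * c T' * C.E (Φ * (C.comp f T * C.comp f T')) else 0)| ≤ e := by
    intro T hT T' hT'
    split_ifs with h
    · simpa using he0
    · rw [sub_zero, abs_mul, abs_mul]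
      have h1 := C.abs_E_mul_comp_mul_comp_le (f := f) hB hΦ hΦB (hA T hT) (hA T' hT') h
      have h2 := mul_le_one₀ (hc T) (abs_nonneg _) (hc T')
      calc _ ≤ 1 * e := mul_le_mul h2 h1 (abs_nonneg _) zero_le_one
        _ = e := one_mul e
  calc _ ≤ ∑ T ∈ A, ∑ T' ∈ A, e := (abs_sum_le_sum_abs _ _).trans
        (sum_le_sum fun T hT => (abs_sum_le_sum_abs _ _).trans
          (sum_le_sum fun T' hT' => hterm T hT T' hT'))
    _ = A.card * (A.card * e) := by simp
    _ ≤ 2 ^ k * (2 ^ k * e) := by gcongr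
    _ = _ := by rw [he]; ring

lemma sum_comp (f : Ω → ℝ) : ∑ T, C.comp f T = f := by
  have h := sum_altSum (fun R => C.P R f) univ
  rw [C.P_univ, powerset_univ] at h
  exact h

lemma abs_E_sq_sum_smul_comp_sub_le (f : Ω → ℝ) {c : Finset (Fin k) → ℝ} (hc : ∀ T, |c T| ≤ 1) :
    |C.E ((∑ T, c T • C.comp f T) ^ 2) - ∑ T, c T ^ 2 * C.E (C.comp f T ^ 2)| ≤
      (2 ^ k) ^ 6 * γ * C.nrm f ^ 2 := by
  have h := C.abs_E_mul_sq_sum_comp_sub_le (f := f) (Φ := 1) (B := 1) zero_le_one (S := ∅)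
    (C.P_one ∅) (fun x => by simp) (A := univ) (fun T _ => empty_subset T) hc
  simpa using h

lemma sum_E_sq_comp_le (f : Ω → ℝ) :
    ∑ T, C.E (C.comp f T ^ 2) ≤ (1 + (2 ^ k) ^ 6 * γ) * C.nrm f ^ 2 := by
  have h := C.abs_E_sq_sum_smul_comp_sub_le f (c := fun _ => 1) (fun _ => by simp)
  simp only [one_smul, one_pow, one_mul, C.sum_comp, ← C.nrm_sq f] at h
  linarith [(abs_le.1 h).1]

lemma E_sq_sum_smul_comp_le (f : Ω → ℝ) {c : Finset (Fin k) → ℝ} (hc : ∀ T, |c T| ≤ 1) :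
    C.E ((∑ T, c T • C.comp f T) ^ 2) ≤ (1 + 2 * ((2 ^ k) ^ 6 * γ)) * C.nrm f ^ 2 := by
  have h := C.abs_E_sq_sum_smul_comp_sub_le f hc
  have h1 := C.sum_E_sq_comp_le f
  have h2 : ∑ T, c T ^ 2 * C.E (C.comp f T ^ 2) ≤ ∑ T, C.E (C.comp f T ^ 2) :=
    sum_le_sum fun T _ => mul_le_of_le_one_left (C.E_nonneg fun _ => sq_nonneg _)
      ((sq_le_one_iff_abs_le_one _).2 (hc T))
  linarith [(abs_le.1 h).2]

lemma sq_sum_comp_superset_le (f : Ω → ℝ) (S : Finset (Fin k)) :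
    (∑ T ∈ univ.filter (S ⊆ ·), C.comp f T) ^ 2 ≤
      (2 : ℝ) ^ S.card • ∑ R ∈ S.powerset, C.P Rᶜ (f ^ 2) := by
  intro x
  have h := sum_altSum_superset (fun R => C.P R f) S
  have h' : ∑ T ∈ univ.filter (S ⊆ ·), C.comp f T =
      ∑ R ∈ S.powerset, (-1 : ℝ) ^ R.card • C.P Rᶜ f := h
  rw [h']
  simp only [Pi.pow_apply, Finset.sum_apply, Pi.smul_apply, smul_eq_mul]
  refine (sq_sum_le_card_mul_sum_sq).trans ?_
  rw [card_powerset]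
  push_cast
  gcongr with R hR
  rw [mul_pow, ← pow_mul, mul_comm R.card, pow_mul]
  simpa using C.sq_P_le Rᶜ f x

lemma E_sq_energy_le {f : Ω → ℝ} {M e : ℝ} (hM : 0 ≤ M) (hf : ∀ x, |f x| ≤ M)
    {i : ℕ} (hfe : ∀ S : Finset (Fin k), S.card ≤ i → ∀ x, C.P S (f ^ 2) x ≤ e)
    {w : Finset (Fin k) → ℝ} (hw0 : ∀ T, 0 ≤ w T) (hw : ∀ T, w T ≤ (1 / 8) ^ T.card)
    (hwi : ∀ T : Finset (Fin k), i < T.card → w T = 0) (S : Finset (Fin k)) :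
    C.E (C.energy f w S ^ 2) ≤ e * ((1 / 2) ^ S.card * C.E (C.energy f w S)) +
      2 * ((2 ^ k) ^ 9 * γ * M ^ 2 * C.nrm f ^ 2) := by
  have hγ := C.γ_nonneg
  have hN := C.nrm_nonneg f
  have hp := one_le_two_pow (k := k)
  set Φ := C.energy f w S with hΦdef
  by_cases hSi : i < S.card
  · have h0 : Φ = 0 := by
      rw [hΦdef, energy]
      refine sum_eq_zero fun T hT => ?_
      rw [hwi T (hSi.trans_le (card_le_card (mem_filter.1 hT).2)), zero_smul]
    rw [h0]
    simp only [ne_eq, OfNat.ofNat_ne_zero, not_false_eq_true, zero_pow, map_zero, mul_zero,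
      zero_add]
    positivity
  rw [not_lt] at hSi
  have hw1 : ∀ T, w T ≤ 1 := fun T => (hw T).trans (pow_le_one₀ (by norm_num) (by norm_num))
  have hΦ0 : 0 ≤ Φ := fun x => by
    rw [hΦdef, energy, Finset.sum_apply]
    exact sum_nonneg fun T _ => mul_nonneg (hw0 T) (C.P_sq_nonneg _ _ _)
  have hPΦ : C.P S Φ = Φ := by
    rw [hΦdef, energy, map_sum]
    refine sum_congr rfl fun T _ => ?_
    rw [map_smul, C.P_P_of_superset _ _ _ le_rfl]
  have hcardA : ((univ.filter (S ⊆ ·)).card : ℝ) ≤ 2 ^ k := by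
    rw [← card_univ_eq]
    exact_mod_cast card_le_univ _
  have hΦB : ∀ x, |Φ x| ≤ (2 ^ k) ^ 3 * M ^ 2 := fun x => by
    rw [abs_of_nonneg (hΦ0 x), hΦdef, energy, Finset.sum_apply]
    calc _ ≤ ∑ T ∈ univ.filter (S ⊆ ·), (2 ^ k * M) ^ 2 := by
          refine sum_le_sum fun T _ => ?_
          have h1 : C.P S (C.comp f T ^ 2) x ≤ (2 ^ k * M) ^ 2 :=
            C.P_le_const S (fun y => sq_le_sq' (abs_le.1 (C.abs_comp_le hf T y)).1
              (abs_le.1 (C.abs_comp_le hf T y)).2) x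
          rw [Pi.smul_apply, smul_eq_mul]
          exact (mul_le_of_le_one_left (C.P_sq_nonneg _ _ _) (hw1 T)).trans h1
      _ = (univ.filter (S ⊆ ·)).card * (2 ^ k * M) ^ 2 := by simp
      _ ≤ 2 ^ k * (2 ^ k * M) ^ 2 := by gcongr
      _ = _ := by ring
  have hnΦ : C.nrm Φ ≤ (2 ^ k) ^ 3 * (M * C.nrm f) := by
    rw [hΦdef, energy]
    refine (C.nrm_sum_le _ _).trans ?_
    calc _ ≤ ∑ T ∈ univ.filter (S ⊆ ·), (2 ^ k) ^ 2 * (M * C.nrm f) := by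
          refine sum_le_sum fun T _ => ?_
          rw [nrm_smul, abs_of_nonneg (hw0 T)]
          refine (mul_le_of_le_one_left (C.nrm_nonneg _) (hw1 T)).trans ?_
          refine (C.nrm_P_le _ _).trans ?_
          rw [sq]
          exact C.nrm_comp_mul_comp_le hM hf T T
      _ = (univ.filter (S ⊆ ·)).card * ((2 ^ k) ^ 2 * (M * C.nrm f)) := by simp
      _ ≤ 2 ^ k * ((2 ^ k) ^ 2 * (M * C.nrm f)) := by gcongr
      _ = _ := by ring
  have hnf : C.nrm (f ^ 2) ≤ M * C.nrm f := by
    rw [sq]; exact C.nrm_mul_le hf f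
  have hR : ∀ R, C.E (Φ * C.P R (f ^ 2)) ≤
      e * C.E Φ + (2 ^ k) ^ 5 * γ * M ^ 2 * C.nrm f ^ 2 := fun R => by
    have h1 := C.abs_E_mul_P_P_sub_le S R (f ^ 2) Φ
    rw [← C.E_P_mul_comm S, hPΦ] at h1
    have h2 : (2 ^ k) ^ 2 * γ * (C.nrm Φ * C.nrm (f ^ 2)) ≤
        (2 ^ k) ^ 5 * γ * M ^ 2 * C.nrm f ^ 2 := by
      calc _ ≤ (2 ^ k) ^ 2 * γ * (((2 ^ k) ^ 3 * (M * C.nrm f)) * (M * C.nrm f)) := by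
            gcongr
            exact C.nrm_nonneg _
        _ = _ := by ring
    have h3 : C.E (Φ * C.P (S ∩ R) (f ^ 2)) ≤ e * C.E Φ := by
      rw [← smul_eq_mul e, ← map_smul C.E]
      refine C.E_mono fun x => ?_
      rw [Pi.mul_apply, Pi.smul_apply, smul_eq_mul, mul_comm]
      exact mul_le_mul_of_nonneg_right
        (hfe _ ((card_le_card inter_subset_left).trans hSi) x) (hΦ0 x)
    linarith [(abs_le.1 h1).2]
  have hsq : C.E (Φ ^ 2) ≤
      (1 / 8) ^ S.card * ∑ T ∈ univ.filter (S ⊆ ·), C.E (Φ * C.comp f T ^ 2) := by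
    have h1 : Φ ^ 2 = ∑ T ∈ univ.filter (S ⊆ ·), w T • (Φ * C.P S (C.comp f T ^ 2)) := by
      rw [sq]
      nth_rewrite 2 [hΦdef]
      rw [energy, mul_sum]
      exact sum_congr rfl fun T _ => mul_smul_comm _ _ _
    rw [h1, map_sum, mul_sum]
    refine sum_le_sum fun T hT => ?_
    rw [map_smul, smul_eq_mul, ← C.E_P_mul_comm, hPΦ]
    refine mul_le_mul_of_nonneg_right ((hw T).trans ?_)
      (C.E_nonneg fun x => mul_nonneg (hΦ0 x) (sq_nonneg _))
    exact pow_le_pow_of_le_one (by norm_num) (by norm_num) (card_le_card (mem_filter.1 hT).2)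
  have hweighted : ∑ T ∈ univ.filter (S ⊆ ·), C.E (Φ * C.comp f T ^ 2) ≤
      4 ^ S.card * (e * C.E Φ + (2 ^ k) ^ 5 * γ * M ^ 2 * C.nrm f ^ 2) +
        (2 ^ k) ^ 9 * γ * M ^ 2 * C.nrm f ^ 2 := by
    have h1 := C.abs_E_mul_sq_sum_comp_sub_le (f := f) (by positivity) hPΦ hΦB
      (A := univ.filter (S ⊆ ·)) (fun T hT => (mem_filter.1 hT).2) (c := fun _ => 1)
      (fun _ => by simp)
    simp only [one_smul, one_pow, one_mul] at h1
    have h2 : C.E (Φ * (∑ T ∈ univ.filter (S ⊆ ·), C.comp f T) ^ 2) ≤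
        4 ^ S.card * (e * C.E Φ + (2 ^ k) ^ 5 * γ * M ^ 2 * C.nrm f ^ 2) := by
      calc _ ≤ C.E (Φ * ((2 : ℝ) ^ S.card • ∑ R ∈ S.powerset, C.P Rᶜ (f ^ 2))) :=
            C.E_mono fun x => mul_le_mul_of_nonneg_left (C.sq_sum_comp_superset_le f S x) (hΦ0 x)
        _ = 2 ^ S.card * ∑ R ∈ S.powerset, C.E (Φ * C.P Rᶜ (f ^ 2)) := by
            rw [mul_smul_comm, map_smul, smul_eq_mul, mul_sum, map_sum]
        _ ≤ 2 ^ S.card * ∑ R ∈ S.powerset, (e * C.E Φ + (2 ^ k) ^ 5 * γ * M ^ 2 * C.nrm f ^ 2) := by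
            gcongr with R _
            exact hR Rᶜ
        _ = _ := by
            rw [sum_const, card_powerset, nsmul_eq_mul, ← mul_assoc]
            push_cast
            rw [← mul_pow]
            norm_num
    have h3 : (2 ^ k) ^ 3 * M ^ 2 * (2 ^ k) ^ 6 * γ * C.nrm f ^ 2 =
        (2 ^ k) ^ 9 * γ * M ^ 2 * C.nrm f ^ 2 := by ring
    linarith [(abs_le.1 h1).1]
  have hE0 : 0 ≤ C.E Φ := C.E_nonneg hΦ0
  set q := γ * M ^ 2 * C.nrm f ^ 2 with hq
  have hq0 : 0 ≤ q := by positivity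
  have h59 : ((2 : ℝ) ^ k) ^ 5 * q ≤ (2 ^ k) ^ 9 * q := by
    gcongr ?_ * q
    exact pow_le_pow_right₀ hp (by norm_num)
  have h84 : ((1 : ℝ) / 8) ^ S.card * 4 ^ S.card = (1 / 2) ^ S.card := by
    rw [← mul_pow]; norm_num
  have h2le : ((1 : ℝ) / 2) ^ S.card ≤ 1 := pow_le_one₀ (by norm_num) (by norm_num)
  have h8le : ((1 : ℝ) / 8) ^ S.card ≤ 1 := pow_le_one₀ (by norm_num) (by norm_num)
  have h9 : 0 ≤ ((2 : ℝ) ^ k) ^ 9 * q := by positivity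
  have h5 : 0 ≤ ((2 : ℝ) ^ k) ^ 5 * q := by positivity
  calc _ ≤ (1 / 8) ^ S.card * (4 ^ S.card * (e * C.E Φ + (2 ^ k) ^ 5 * γ * M ^ 2 * C.nrm f ^ 2) +
        (2 ^ k) ^ 9 * γ * M ^ 2 * C.nrm f ^ 2) :=
        hsq.trans (mul_le_mul_of_nonneg_left hweighted (by positivity))
    _ = ((1 / 8) ^ S.card * 4 ^ S.card) * (e * C.E Φ) +
        ((1 / 8) ^ S.card * 4 ^ S.card) * ((2 ^ k) ^ 5 * q) + (1 / 8) ^ S.card * ((2 ^ k) ^ 9 * q) := by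
        rw [hq]; ring
    _ ≤ (1 / 2) ^ S.card * (e * C.E Φ) + (2 ^ k) ^ 5 * q + (2 ^ k) ^ 9 * q := by
        rw [h84]
        exact add_le_add (add_le_add le_rfl (mul_le_of_le_one_left h5 h2le))
          (mul_le_of_le_one_left h9 h8le)
    _ ≤ (1 / 2) ^ S.card * (e * C.E Φ) + 2 * ((2 ^ k) ^ 9 * q) := by linarith
    _ = _ := by rw [hq]; ring

/-- Hypercontractive bound for a pseudorandom function: components damped geometrically. -/
lemma E_pow_four_sum_smul_comp_le {f : Ω → ℝ} {M e : ℝ} (hM : 0 ≤ M) (hf : ∀ x, |f x| ≤ M)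
    (he : 0 ≤ e) {i : ℕ} (hfe : ∀ S : Finset (Fin k), S.card ≤ i → ∀ x, C.P S (f ^ 2) x ≤ e)
    {c : Finset (Fin k) → ℝ} (hc : ∀ T, |c T| ≤ (1 / 8) ^ T.card)
    (hci : ∀ T : Finset (Fin k), i < T.card → c T = 0) :
    C.E ((∑ T, c T • C.comp f T) ^ 4) ≤ e * ((1 + (2 ^ k) ^ 6 * γ) * C.nrm f ^ 2) +
      5 * ((2 ^ k) ^ 10 * γ * M ^ 2 * C.nrm f ^ 2) := by
  have hγ := C.γ_nonneg
  have hN := C.nrm_nonneg f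
  have hp := one_le_two_pow (k := k)
  set w : Finset (Fin k) → ℝ := fun T => c T ^ 2 * 8 ^ T.card with hw
  have hw0 : ∀ T, 0 ≤ w T := fun T => by positivity
  have hwle : ∀ T, w T ≤ (1 / 8) ^ T.card := fun T => by
    have h1 : c T ^ 2 ≤ ((1 / 8) ^ T.card) ^ 2 := by
      rw [← sq_abs]
      exact pow_le_pow_left₀ (abs_nonneg _) (hc T) 2
    calc _ ≤ ((1 / 8) ^ T.card) ^ 2 * (8 : ℝ) ^ T.card := mul_le_mul_of_nonneg_right h1 (by positivity)
      _ = (1 / 8) ^ T.card * ((1 / 8) * 8) ^ T.card := by rw [mul_pow]; ring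
      _ = _ := by norm_num
  have hwi : ∀ T : Finset (Fin k), i < T.card → w T = 0 := fun T hT => by simp [hw, hci T hT]
  have h1 := C.E_pow_four_le_sum_pairTerm hM hf
    (fun T => (hc T).trans (pow_le_one₀ (by norm_num) (by norm_num)))
  have h2 := C.sum_E_sq_sum_pairTerm_le hM hf hc
  set q := γ * M ^ 2 * C.nrm f ^ 2 with hq
  have hq0 : 0 ≤ q := by positivity
  have h3 : ∑ S, C.E (C.energy f w S ^ 2) ≤
      e * ∑ S : Finset (Fin k), (1 / 2) ^ S.card * C.E (C.energy f w S) + 2 * ((2 ^ k) ^ 10 * q) := by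
    calc _ ≤ ∑ S : Finset (Fin k), (e * ((1 / 2) ^ S.card * C.E (C.energy f w S)) +
          2 * ((2 ^ k) ^ 9 * γ * M ^ 2 * C.nrm f ^ 2)) :=
          sum_le_sum fun S _ => C.E_sq_energy_le hM hf hfe hw0 hwle hwi S
      _ = _ := by
          rw [sum_add_distrib, ← mul_sum, sum_const, nsmul_eq_mul, card_univ_eq, hq]
          ring
  have h4 : ∑ S : Finset (Fin k), (1 / 2) ^ S.card * C.E (C.energy f w S) ≤
      ∑ T, C.E (C.comp f T ^ 2) := by
    calc _ = ∑ S : Finset (Fin k), ∑ T : Finset (Fin k), if S ⊆ T then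
          (1 / 2) ^ S.card * (w T * C.E (C.comp f T ^ 2)) else 0 := by
          refine sum_congr rfl fun S _ => ?_
          rw [energy, map_sum, mul_sum, sum_filter]
          refine sum_congr rfl fun T _ => ?_
          split_ifs
          · rw [map_smul, smul_eq_mul, C.E_P]
          · rfl
      _ = ∑ T : Finset (Fin k), ∑ S ∈ T.powerset, (1 / 2) ^ S.card * (w T * C.E (C.comp f T ^ 2)) := by
          rw [sum_comm]
          refine sum_congr rfl fun T _ => ?_
          rw [← sum_filter]
          refine sum_congr ?_ fun _ _ => rfl
          ext S
          simp
      _ ≤ _ := by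
          refine sum_le_sum fun T _ => ?_
          have hE : 0 ≤ C.E (C.comp f T ^ 2) := C.E_nonneg fun _ => sq_nonneg _
          calc _ ≤ ∑ S ∈ T.powerset, (1 / 8) ^ T.card * C.E (C.comp f T ^ 2) := by
                refine sum_le_sum fun S _ => ?_
                refine (mul_le_of_le_one_left (mul_nonneg (hw0 T) hE)
                  (pow_le_one₀ (by norm_num) (by norm_num))).trans ?_
                exact mul_le_mul_of_nonneg_right (hwle T) hE
            _ = (2 * (1 / 8)) ^ T.card * C.E (C.comp f T ^ 2) := by
                rw [sum_const, card_powerset, nsmul_eq_mul, mul_pow]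
                push_cast
                ring
            _ ≤ _ := mul_le_of_le_one_left hE (pow_le_one₀ (by norm_num) (by norm_num))
  have h5 : e * ∑ S : Finset (Fin k), (1 / 2) ^ S.card * C.E (C.energy f w S) ≤
      e * ((1 + (2 ^ k) ^ 6 * γ) * C.nrm f ^ 2) :=
    mul_le_mul_of_nonneg_left (h4.trans (C.sum_E_sq_comp_le f)) he
  have h6 : ((2 : ℝ) ^ k) ^ 9 * q ≤ (2 ^ k) ^ 10 * q := by
    gcongr ?_ * q
    exact pow_le_pow_right₀ hp (by norm_num)
  have e1 : ∀ m : ℕ, (2 ^ k) ^ m * γ * M ^ 2 * C.nrm f ^ 2 = (2 ^ k) ^ m * q := fun m => by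
    rw [hq]; ring
  rw [e1] at h1 h2 ⊢
  linarith

end CondSystem

namespace CondSystem

variable {Ω : Type*} [Fintype Ω] {k : ℕ} {γ : ℝ} (C : CondSystem Ω k γ)

lemma comp_empty (f : Ω → ℝ) : C.comp f ∅ = fun _ => C.E f := by
  ext x
  simp [comp_apply, altSum, C.P_empty, E_apply]

lemma comp_sub (f g : Ω → ℝ) (T : Finset (Fin k)) :
    C.comp (f - g) T = C.comp f T - C.comp g T := by
  simp [comp, altSum, smul_sub]

lemma comp_const (c : ℝ) {T : Finset (Fin k)} (hT : T.Nonempty) : C.comp (fun _ => c) T = 0 := by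
  obtain ⟨v, hv⟩ := hT
  exact altSum_eq_zero _ hv fun R => by simp only [P_const]

lemma E_comp (f : Ω → ℝ) {T : Finset (Fin k)} (hT : T.Nonempty) : C.E (C.comp f T) = 0 := by
  obtain ⟨v, hv⟩ := hT
  have h := altSum_eq_zero (fun R => C.E (C.P R f)) hv fun R => by simp only [E_P]
  rw [← h, comp, altSum, altSum, map_sum]
  exact sum_congr rfl fun R _ => map_smul _ _ _

lemma sum_smul_comp_eq_of_level_eq_zero {f : Ω → ℝ} {i : ℕ}
    (h : ∀ j, i < j → j ≤ k → ∑ T ∈ powersetCard j univ, C.comp f T = 0) (φ : ℕ → ℝ) :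
    ∑ T, φ T.card • C.comp f T = ∑ T, (if T.card ≤ i then φ T.card else 0) • C.comp f T := by
  rw [← powerset_univ, sum_powerset, sum_powerset]
  refine sum_congr rfl fun j hj => ?_
  have h1 : ∀ ψ : ℕ → ℝ, ∑ T ∈ powersetCard j (univ : Finset (Fin k)), ψ T.card • C.comp f T =
      ψ j • ∑ T ∈ powersetCard j univ, C.comp f T := fun ψ => by
    rw [smul_sum]
    exact sum_congr rfl fun T hT => by rw [(mem_powersetCard.1 hT).2]
  rw [h1 φ, h1 fun m => if m ≤ i then φ m else 0]
  by_cases hji : j ≤ i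
  · rw [if_pos hji]
  · rw [h j (not_le.1 hji) (by simpa [Nat.lt_succ_iff] using hj), smul_zero, smul_zero]

lemma P_le_of_card_le {g : Ω → ℝ} {i : ℕ} (hi : i ≤ k) {B : ℝ}
    (h : ∀ S : Finset (Fin k), S.card = i → ∀ x, C.P S g x ≤ B) (S : Finset (Fin k))
    (hS : S.card ≤ i) (x : Ω) : C.P S g x ≤ B := by
  obtain ⟨S', hSS', hS'⟩ := exists_superset_card_eq hS (by simpa using hi)
  rw [← C.P_P_of_subset S S' g hSS']
  exact C.P_le_const S (h S' hS') x

lemma abs_P_le_of_card_le {g : Ω → ℝ} {i : ℕ} (hi : i ≤ k) {B : ℝ}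
    (h : ∀ S : Finset (Fin k), S.card = i → ∀ x, |C.P S g x| ≤ B) (S : Finset (Fin k))
    (hS : S.card ≤ i) (x : Ω) : |C.P S g x| ≤ B := by
  obtain ⟨S', hSS', hS'⟩ := exists_superset_card_eq hS (by simpa using hi)
  rw [← C.P_P_of_subset S S' g hSS']
  exact C.abs_P_le S (h S' hS') x

lemma E_pow_four_const_add_le {c : ℝ} {h : Ω → ℝ} (h0 : C.E h = 0) :
    C.E ((fun x => c + h x) ^ 4) ≤ c ^ 4 + 8 * c ^ 2 * C.E (h ^ 2) + 3 * C.E (h ^ 4) := by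
  have h1 : C.E ((fun _ => c ^ 4) + (4 * c ^ 3) • h + (8 * c ^ 2) • h ^ 2 + (3 : ℝ) • h ^ 4) =
      c ^ 4 + 8 * c ^ 2 * C.E (h ^ 2) + 3 * C.E (h ^ 4) := by
    rw [map_add, map_add, map_add, map_smul, map_smul, map_smul, C.E_const, h0]
    simp
  rw [← h1]
  refine C.E_mono fun x => ?_
  simp only [Pi.pow_apply, Pi.add_apply, Pi.smul_apply, smul_eq_mul]
  nlinarith [sq_nonneg (c * h x - h x ^ 2)]

theorem noise_pow_four_le (hγ : γ = (1 / 4096) ^ k) {f : Ω → ℝ} {M ε : ℝ}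
    (hε : 0 ≤ ε) (hf : ∀ x, |f x| ≤ M) (hfM : ∃ x, |f x| = M) {i : ℕ} (hi : i ≤ k)
    (h1 : ∀ S : Finset (Fin k), S.card = i → ∀ x, |C.P S f x| ≤ ε * M)
    (h2 : ∀ S : Finset (Fin k), S.card = i → ∀ x, C.P S (f ^ 2) x ≤ ε * M ^ 2)
    (hdeg : ∀ j, i < j → j ≤ k → ∑ T ∈ powersetCard j univ, C.comp f T = 0) :
    C.E ((∑ T, (1 / 64 : ℝ) ^ T.card • C.comp f T) ^ 4) ≤ ε * C.E (f ^ 2) * M ^ 2 := by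
  obtain ⟨x₀, hx₀⟩ := hfM
  have hM : 0 ≤ M := hx₀ ▸ abs_nonneg _
  have h1' := C.abs_P_le_of_card_le hi h1
  have h2' := C.P_le_of_card_le hi h2
  have hp6 : (2 ^ k) ^ 6 * γ ≤ 1 := by
    have : (2 ^ k) ^ 6 * γ = (1 / 64) ^ k := by
      rw [hγ, ← pow_mul, mul_comm k, pow_mul, ← mul_pow]; norm_num
    rw [this]
    exact pow_le_one₀ (by norm_num) (by norm_num)
  have hMε : M ≤ 3 ^ k * (ε * M) := by
    have h := C.sum_smul_comp_eq_of_level_eq_zero hdeg (fun _ => 1)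
    simp only [one_smul, C.sum_comp] at h
    have hx := congrFun h x₀
    rw [Finset.sum_apply] at hx
    have h3 : ∑ T : Finset (Fin k), (2 : ℝ) ^ T.card = 3 ^ k := by
      have := Fin.sum_pow_mul_eq_add_pow (n := k) (2 : ℝ) 1
      simp only [one_pow, mul_one] at this
      rw [this]; norm_num
    calc M = |f x₀| := hx₀.symm
      _ ≤ _ := ?_
    rw [← h3, sum_mul, hx]
    refine (abs_sum_le_sum_abs _ _).trans (sum_le_sum fun T _ => ?_)
    split_ifs with hT
    · simpa using C.abs_comp_le_of_card_le hT x₀ fun S hS => h1' S hS x₀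
    · simpa using by positivity
  have hp10 : (2 ^ k) ^ 10 * γ * M ^ 2 ≤ ε * M ^ 2 := by
    have h3 : (2 ^ k) ^ 10 * γ = (1 / 4) ^ k := by
      rw [hγ, ← pow_mul, mul_comm k, pow_mul, ← mul_pow]; norm_num
    have h4 : (3 / 4 : ℝ) ^ k ≤ 1 := pow_le_one₀ (by norm_num) (by norm_num)
    rw [h3]
    calc (1 / 4 : ℝ) ^ k * M ^ 2 = (1 / 4) ^ k * (M * M) := by ring
      _ ≤ (1 / 4) ^ k * ((3 ^ k * (ε * M)) * M) := by gcongr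
      _ = ((1 / 4) * 3) ^ k * (ε * M ^ 2) := by rw [mul_pow]; ring
      _ ≤ 1 * (ε * M ^ 2) := by
          gcongr
          exact pow_le_one₀ (by norm_num) (by norm_num)
      _ = _ := one_mul _
  set c := C.E f with hc
  set e := ε * M ^ 2 with he
  have he0 : 0 ≤ e := by positivity
  have hPc : C.P ∅ f x₀ = c := C.P_empty f x₀
  have hPc2 : C.P ∅ (f ^ 2) x₀ = C.E (f ^ 2) := C.P_empty _ x₀
  have hc2 : c ^ 2 ≤ C.E (f ^ 2) := by
    rw [← hPc, ← hPc2]; exact C.sq_P_le ∅ f x₀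
  have hce : c ^ 2 ≤ e := by
    refine hc2.trans ?_
    rw [← hPc2]; exact h2' ∅ (by simp) x₀
  have hcM : |c| ≤ M := hPc ▸ C.abs_P_le ∅ hf x₀
  set g : Ω → ℝ := f - fun _ => c with hg
  have hgM : ∀ x, |g x| ≤ 2 * M := fun x => by
    have := abs_sub (f x) c
    simp only [hg, Pi.sub_apply]
    linarith [hf x]
  have hgN : C.nrm g ^ 2 = C.E (f ^ 2) - c ^ 2 := by
    have h3 : g ^ 2 = f ^ 2 - (2 * c) • f + fun _ => c ^ 2 := by
      ext x; simp [hg]; ring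
    rw [nrm_sq, h3, map_add, map_sub, map_smul, E_const, ← hc, smul_eq_mul]
    ring
  have hge : ∀ S : Finset (Fin k), S.card ≤ i → ∀ x, C.P S (g ^ 2) x ≤ 4 * e := fun S hS x => by
    have h3 : g ^ 2 ≤ (2 : ℝ) • f ^ 2 + fun _ => 2 * c ^ 2 := fun y => by
      simp only [hg, Pi.pow_apply, Pi.sub_apply, Pi.add_apply, Pi.smul_apply, smul_eq_mul]
      nlinarith [sq_nonneg (f y + c)]
    have h4 := C.P_mono S h3 x
    rw [map_add, map_smul, P_const] at h4
    simp only [Pi.add_apply, Pi.smul_apply, smul_eq_mul] at h4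
    linarith [h2' S hS x]
  set b : Finset (Fin k) → ℝ := fun T =>
    if T = ∅ ∨ i < T.card then 0 else 8 * (1 / 64) ^ T.card with hb
  have hbi : ∀ T : Finset (Fin k), i < T.card → b T = 0 := fun T hT => by simp [hb, hT]
  have hb8 : ∀ T, |b T| ≤ (1 / 8) ^ T.card := fun T => by
    simp only [hb]
    split_ifs with h
    · simp
    · rw [not_or] at h
      obtain ⟨m, hm⟩ : ∃ m, T.card = m + 1 :=
        Nat.exists_eq_succ_of_ne_zero (card_ne_zero.2 (nonempty_iff_ne_empty.2 h.1))
      rw [abs_of_nonneg (by positivity), hm]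
      have h3 : (1 / 64 : ℝ) ^ m ≤ (1 / 8) ^ m := by gcongr; norm_num
      rw [pow_succ, pow_succ]
      linarith
  have hb1 : ∀ T, |b T| ≤ 1 := fun T => (hb8 T).trans (pow_le_one₀ (by norm_num) (by norm_num))
  set G := ∑ T, b T • C.comp g T with hG
  have hEG : C.E G = 0 := by
    rw [hG, map_sum]
    refine sum_eq_zero fun T _ => ?_
    rcases T.eq_empty_or_nonempty with rfl | hT
    · simp [hb]
    · rw [map_smul, C.E_comp g hT, smul_zero]
  have hT : ∑ T, (1 / 64 : ℝ) ^ T.card • C.comp f T = fun x => c + ((1 / 8 : ℝ) • G) x := by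
    rw [C.sum_smul_comp_eq_of_level_eq_zero hdeg fun m => (1 / 64) ^ m]
    have h3 : ∀ T : Finset (Fin k), (if T.card ≤ i then (1 / 64 : ℝ) ^ T.card else 0) • C.comp f T =
        (if T = ∅ then C.comp f ∅ else 0) + (1 / 8 : ℝ) • (b T • C.comp g T) := fun T => by
      rcases T.eq_empty_or_nonempty with rfl | hT
      · simp [hb]
      · rw [if_neg hT.ne_empty, zero_add, hg, C.comp_sub, C.comp_const c hT, sub_zero, smul_smul]
        congr 1
        simp only [hb, hT.ne_empty, false_or]
        split_ifs with h4 h5 h5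
        · omega
        · ring
        · simp
        · omega
    rw [sum_congr rfl fun T _ => h3 T, sum_add_distrib, ← smul_sum, ← hG, sum_ite_eq' , if_pos (mem_univ _),
      C.comp_empty]
    rfl
  have hE2 : C.E (G ^ 2) ≤ 3 * C.nrm g ^ 2 := by
    refine (C.E_sq_sum_smul_comp_le g hb1).trans ?_
    gcongr
    linarith
  have hE4 : C.E (G ^ 4) ≤ 28 * e * C.nrm g ^ 2 := by
    refine (C.E_pow_four_sum_smul_comp_le (by positivity) hgM (by positivity) hge hb8 hbi).trans ?_
    have hN := sq_nonneg (C.nrm g)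
    have h3 : 4 * e * ((1 + (2 ^ k) ^ 6 * γ) * C.nrm g ^ 2) ≤ 4 * e * (2 * C.nrm g ^ 2) := by
      gcongr
      linarith
    have h4 : (2 ^ k) ^ 10 * γ * M ^ 2 * C.nrm g ^ 2 ≤ e * C.nrm g ^ 2 := by gcongr
    nlinarith
  have hE2' : C.E (((1 / 8 : ℝ) • G) ^ 2) = 1 / 64 * C.E (G ^ 2) := by
    rw [smul_pow, map_smul, smul_eq_mul]; norm_num
  have hE4' : C.E (((1 / 8 : ℝ) • G) ^ 4) = 1 / 4096 * C.E (G ^ 4) := by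
    rw [smul_pow, map_smul, smul_eq_mul]; norm_num
  have hfin := C.E_pow_four_const_add_le (c := c) (h := (1 / 8 : ℝ) • G)
    (by rw [map_smul, hEG, smul_zero])
  rw [hE2', hE4'] at hfin
  rw [hT]
  refine hfin.trans ?_
  have hN := sq_nonneg (C.nrm g)
  have hf2 : ε * C.E (f ^ 2) * M ^ 2 = e * c ^ 2 + e * C.nrm g ^ 2 := by
    rw [hgN, he]; ring
  have h5 : c ^ 4 ≤ e * c ^ 2 := by nlinarith [sq_nonneg c]
  have h6 : c ^ 2 * C.E (G ^ 2) ≤ e * (3 * C.nrm g ^ 2) :=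
    mul_le_mul hce hE2 (C.E_nonneg fun _ => sq_nonneg _) he0
  have h7 := mul_nonneg he0 hN
  rw [hf2]
  nlinarith

end CondSystem

section Cylinder

variable {Ω V : Type*} [Fintype Ω] [DecidableEq V] {k : ℕ}

/-- The points agreeing with `x` on the coordinates in `S`. -/
def cyl (ξ : Ω → Fin k → V) (S : Finset (Fin k)) (x : Ω) : Finset Ω :=
  univ.filter fun y => ∀ j ∈ S, ξ y j = ξ x j

variable (ξ : Ω → Fin k → V) (μ : Ω → ℝ)

lemma mem_cyl {S : Finset (Fin k)} {x y : Ω} : y ∈ cyl ξ S x ↔ ∀ j ∈ S, ξ y j = ξ x j := by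
  simp [cyl]

lemma cyl_eq_of_mem {S : Finset (Fin k)} {x y : Ω} (h : y ∈ cyl ξ S x) :
    cyl ξ S y = cyl ξ S x := by
  rw [mem_cyl] at h
  ext z
  rw [mem_cyl, mem_cyl]
  exact forall₂_congr fun j hj => by rw [h j hj]

lemma self_mem_cyl (S : Finset (Fin k)) (x : Ω) : x ∈ cyl ξ S x := by simp [cyl]

lemma mem_cyl_comm {S : Finset (Fin k)} {x y : Ω} : y ∈ cyl ξ S x ↔ x ∈ cyl ξ S y := by
  rw [mem_cyl, mem_cyl]
  exact forall₂_congr fun j _ => eq_comm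

lemma cyl_subset {S T : Finset (Fin k)} (h : S ⊆ T) (x : Ω) : cyl ξ T x ⊆ cyl ξ S x := by
  intro y hy
  rw [mem_cyl] at hy ⊢
  exact fun j hj => hy j (h hj)

/-- Conditional expectation given the coordinates in `S`. -/
noncomputable def condE (S : Finset (Fin k)) : (Ω → ℝ) →ₗ[ℝ] (Ω → ℝ) where
  toFun f x := (∑ y ∈ cyl ξ S x, μ y * f y) / ∑ y ∈ cyl ξ S x, μ y
  map_add' f g := by
    ext x
    simp [mul_add, sum_add_distrib, add_div]
  map_smul' c f := by
    ext x
    simp [mul_left_comm, ← mul_sum, mul_div_assoc]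

lemma condE_apply (S : Finset (Fin k)) (f : Ω → ℝ) (x : Ω) :
    condE ξ μ S f x = (∑ y ∈ cyl ξ S x, μ y * f y) / ∑ y ∈ cyl ξ S x, μ y := rfl

variable {ξ μ}

lemma condE_eq_of_mem {S : Finset (Fin k)} {x y : Ω} (h : y ∈ cyl ξ S x) (f : Ω → ℝ) :
    condE ξ μ S f y = condE ξ μ S f x := by
  rw [condE_apply, condE_apply, cyl_eq_of_mem ξ h]

lemma sum_cyl_pos (hμ : ∀ x, 0 < μ x) (S : Finset (Fin k)) (x : Ω) :
    0 < ∑ y ∈ cyl ξ S x, μ y :=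
  sum_pos (fun y _ => hμ y) ⟨x, self_mem_cyl ξ S x⟩

lemma condE_mul_of_const {S : Finset (Fin k)} {h : Ω → ℝ} {x : Ω}
    (hh : ∀ y ∈ cyl ξ S x, h y = h x) (g : Ω → ℝ) :
    condE ξ μ S (h * g) x = h x * condE ξ μ S g x := by
  rw [condE_apply, condE_apply, ← mul_div_assoc, mul_sum]
  congr 1
  refine sum_congr rfl fun y hy => ?_
  rw [Pi.mul_apply, hh y hy]
  ring

lemma condE_one (hμ : ∀ x, 0 < μ x) (S : Finset (Fin k)) : condE ξ μ S 1 = 1 := by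
  ext x
  rw [condE_apply]
  simpa using div_self (sum_cyl_pos hμ S x).ne'

lemma condE_condE_of_superset (hμ : ∀ x, 0 < μ x) {S T : Finset (Fin k)} (f : Ω → ℝ) (h : S ⊆ T) :
    condE ξ μ T (condE ξ μ S f) = condE ξ μ S f := by
  ext x
  have := condE_mul_of_const (μ := μ) (S := T) (h := condE ξ μ S f) (x := x)
    (fun y hy => condE_eq_of_mem (cyl_subset ξ h x hy) f) 1
  rwa [mul_one, condE_one hμ, Pi.one_apply, mul_one] at this

lemma sum_cyl_condE (hμ : ∀ x, 0 < μ x) {S T : Finset (Fin k)} (f : Ω → ℝ) (h : S ⊆ T) (x : Ω) :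
    ∑ y ∈ cyl ξ S x, μ y * condE ξ μ T f y = ∑ y ∈ cyl ξ S x, μ y * f y := by
  classical
  have h1 : ∀ y ∈ cyl ξ S x, μ y * condE ξ μ T f y = ∑ z ∈ cyl ξ S x,
      if z ∈ cyl ξ T y then μ z * f z * (μ y / ∑ t ∈ cyl ξ T z, μ t) else 0 := by
    intro y hy
    rw [condE_apply, ← sum_filter]
    have h2 : (cyl ξ S x).filter (fun z => z ∈ cyl ξ T y) = cyl ξ T y := by
      ext z
      rw [mem_filter, and_iff_right_iff_imp]
      intro hz
      rw [← cyl_eq_of_mem ξ hy]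
      exact cyl_subset ξ h y hz
    rw [h2, mul_div_assoc', mul_sum, sum_div]
    refine sum_congr rfl fun z hz => ?_
    rw [cyl_eq_of_mem ξ hz]
    ring
  rw [sum_congr rfl h1, sum_comm]
  refine sum_congr rfl fun z hz => ?_
  rw [← sum_filter]
  have h2 : (cyl ξ S x).filter (fun y => z ∈ cyl ξ T y) = cyl ξ T z := by
    ext y
    rw [mem_filter, mem_cyl_comm ξ (S := T), and_iff_right_iff_imp]
    intro hy
    rw [← cyl_eq_of_mem ξ hz]
    exact cyl_subset ξ h z hy
  rw [h2, ← mul_sum, ← sum_div, div_self (sum_cyl_pos hμ T z).ne', mul_one]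

lemma condE_condE_of_subset (hμ : ∀ x, 0 < μ x) {S T : Finset (Fin k)} (f : Ω → ℝ) (h : S ⊆ T) :
    condE ξ μ S (condE ξ μ T f) = condE ξ μ S f := by
  ext x
  rw [condE_apply, sum_cyl_condE hμ f h, condE_apply]

lemma condE_nonneg (hμ : ∀ x, 0 < μ x) (S : Finset (Fin k)) (f : Ω → ℝ) (hf : 0 ≤ f) :
    0 ≤ condE ξ μ S f := fun x =>
  div_nonneg (sum_nonneg fun y _ => mul_nonneg (hμ y).le (hf y)) (sum_cyl_pos hμ S x).le

lemma sum_mul_condE (hμ : ∀ x, 0 < μ x) (S : Finset (Fin k)) (f : Ω → ℝ) :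
    ∑ x, μ x * condE ξ μ S f x = ∑ x, μ x * f x := by
  rcases isEmpty_or_nonempty Ω with h | ⟨⟨x⟩⟩
  · simp
  · simpa [cyl] using sum_cyl_condE hμ f (empty_subset S) x

lemma sum_mul_sq_condE_le (hμ : ∀ x, 0 < μ x) (S : Finset (Fin k)) (f : Ω → ℝ) :
    ∑ x, μ x * condE ξ μ S f x ^ 2 ≤ ∑ x, μ x * f x ^ 2 := by
  have h := sum_mul_condE (ξ := ξ) hμ S (f ^ 2)
  simp only [Pi.pow_apply] at h
  rw [← h]
  refine sum_le_sum fun x _ => mul_le_mul_of_nonneg_left ?_ (hμ x).le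
  rw [condE_apply, condE_apply, div_pow, div_le_div_iff₀ (pow_pos (sum_cyl_pos hμ S x) 2)
    (sum_cyl_pos hμ S x), sq (∑ y ∈ cyl ξ S x, μ y), ← mul_assoc]
  refine mul_le_mul_of_nonneg_right ?_ (sum_cyl_pos hμ S x).le
  refine (sum_sq_le_sum_mul_sum_of_sq_le_mul _ (fun y _ => ?_) (fun y _ => ?_) fun y _ => ?_)
  · exact mul_nonneg (hμ y).le (sq_nonneg (f y))
  · exact (hμ y).le
  · simp only [Pi.pow_apply]
    exact le_of_eq (by ring)

lemma sum_mul_condE_mul (hμ : ∀ x, 0 < μ x) (S : Finset (Fin k)) (a b : Ω → ℝ) :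
    ∑ x, μ x * (condE ξ μ S a x * b x) = ∑ x, μ x * (a x * condE ξ μ S b x) := by
  have key : ∀ a b : Ω → ℝ, ∑ x, μ x * (condE ξ μ S a x * b x) =
      ∑ x, μ x * (condE ξ μ S a x * condE ξ μ S b x) := fun a b => by
    have h := sum_mul_condE (ξ := ξ) hμ S (condE ξ μ S a * b)
    simp only [condE_mul_of_const (fun y hy => condE_eq_of_mem hy a)] at h
    exact h.symm
  rw [key]
  simp only [mul_comm (a _), key b a]
  exact sum_congr rfl fun x _ => by ring

lemma sum_mul_sq_sub_condE_le (hμ : ∀ x, 0 < μ x) {S T : Finset (Fin k)} (h : S ⊆ T) (a : Ω → ℝ) :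
    ∑ x, μ x * (condE ξ μ T a x - condE ξ μ S a x) ^ 2 ≤ ∑ x, μ x * a x ^ 2 := by
  have h1 := sum_mul_sq_condE_le (ξ := ξ) hμ T (a - condE ξ μ S a)
  rw [map_sub, condE_condE_of_superset hμ a h] at h1
  refine h1.trans ?_
  have h2 := sum_mul_condE_mul (ξ := ξ) hμ S (condE ξ μ S a) a
  rw [condE_condE_of_superset hμ a le_rfl] at h2
  have h3 : ∑ x, μ x * (a - condE ξ μ S a) x ^ 2 = ∑ x, μ x * a x ^ 2 -
      2 * ∑ x, μ x * (condE ξ μ S a x * a x) +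
      ∑ x, μ x * (condE ξ μ S a x * condE ξ μ S a x) := by
    rw [mul_sum, ← sum_sub_distrib, ← sum_add_distrib]
    exact sum_congr rfl fun x _ => by rw [Pi.sub_apply]; ring
  have h4 : 0 ≤ ∑ x, μ x * (condE ξ μ S a x * condE ξ μ S a x) :=
    sum_nonneg fun x _ => mul_nonneg (hμ x).le (mul_self_nonneg _)
  rw [h3, h2]
  linarith

lemma sum_le_of_sum_cyl_le (hμ : ∀ x, 0 < μ x) {S : Finset (Fin k)} {u v : Ω → ℝ}
    (h : ∀ x, ∑ y ∈ cyl ξ S x, μ y * u y ≤ ∑ y ∈ cyl ξ S x, μ y * v y) :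
    ∑ x, μ x * u x ≤ ∑ x, μ x * v x := by
  rw [← sum_mul_condE (ξ := ξ) hμ S u, ← sum_mul_condE (ξ := ξ) hμ S v]
  exact sum_le_sum fun x _ => mul_le_mul_of_nonneg_left
    (div_le_div_of_nonneg_right (h x) (sum_cyl_pos hμ S x).le) (hμ x).le

lemma sum_sq_condE_condE_sub_le (hμ : ∀ x, 0 < μ x) {γ : ℝ} (hγ : 0 < γ)
    {S T T' : Finset (Fin k)} (hT : S ⊆ T) (hT' : S ⊆ T')
    (hcorr : ∀ (a b : Ω → ℝ) (x : Ω),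
      ∑ y ∈ cyl ξ S x, μ y * ((condE ξ μ T a y - condE ξ μ S a y) *
          (condE ξ μ T' b y - condE ξ μ S b y)) ≤
        γ / 2 * (∑ y ∈ cyl ξ S x, μ y * (condE ξ μ T a y - condE ξ μ S a y) ^ 2 +
          ∑ y ∈ cyl ξ S x, μ y * (condE ξ μ T' b y - condE ξ μ S b y) ^ 2)) (b : Ω → ℝ) :
    ∑ x, μ x * (condE ξ μ T (condE ξ μ T' b) x - condE ξ μ S b x) ^ 2 ≤
      γ ^ 2 * ∑ x, μ x * b x ^ 2 := by
  set D := condE ξ μ T (condE ξ μ T' b) - condE ξ μ S b with hD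
  have hglobal : ∀ a : Ω → ℝ, ∑ x, μ x * (a x * D x) ≤
      γ / 2 * (∑ x, μ x * a x ^ 2 + ∑ x, μ x * b x ^ 2) := by
    intro a
    set φ := condE ξ μ T a - condE ξ μ S a with hφ
    set ψ := condE ξ μ T' b - condE ξ μ S b with hψ
    have h1 : ∑ x, μ x * (φ x * ψ x) ≤ γ / 2 * (∑ x, μ x * φ x ^ 2 + ∑ x, μ x * ψ x ^ 2) := by
      have := sum_le_of_sum_cyl_le (ξ := ξ) hμ (S := S) (u := φ * ψ)
        (v := fun x => γ / 2 * (φ x ^ 2 + ψ x ^ 2)) fun x => by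
          refine (hcorr a b x).trans (le_of_eq ?_)
          rw [← sum_add_distrib, mul_sum]
          refine sum_congr rfl fun y _ => ?_
          simp only [hφ, hψ, Pi.sub_apply]
          ring
      refine this.trans (le_of_eq ?_)
      rw [← sum_add_distrib, mul_sum]
      exact sum_congr rfl fun y _ => by ring
    have h2 : ∑ x, μ x * (φ x * ψ x) = ∑ x, μ x * (a x * D x) := by
      have h3 : D = condE ξ μ T ψ - condE ξ μ S ψ := by
        rw [hψ, map_sub, map_sub, condE_condE_of_superset hμ b hT, condE_condE_of_subset hμ b hT',
          condE_condE_of_superset hμ b le_rfl, sub_self, sub_zero]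
      have h4 := sum_mul_condE_mul (ξ := ξ) hμ T a ψ
      have h5 := sum_mul_condE_mul (ξ := ξ) hμ S a ψ
      rw [h3, hφ]
      simp only [Pi.sub_apply, sub_mul, mul_sub, sum_sub_distrib]
      rw [h4, h5]
    rw [← h2]
    refine h1.trans ?_
    gcongr ?_ * (?_ + ?_)
    · exact sum_mul_sq_sub_condE_le hμ hT a
    · exact sum_mul_sq_sub_condE_le hμ hT' b
  have h := hglobal (γ⁻¹ • D)
  have e1 : ∑ x, μ x * ((γ⁻¹ • D) x * D x) = γ⁻¹ * ∑ x, μ x * D x ^ 2 := by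
    rw [mul_sum]
    exact sum_congr rfl fun x _ => by simp; ring
  have e2 : ∑ x, μ x * (γ⁻¹ • D) x ^ 2 = γ⁻¹ ^ 2 * ∑ x, μ x * D x ^ 2 := by
    rw [mul_sum]
    exact sum_congr rfl fun x _ => by simp; ring
  rw [e1, e2] at h
  have h6 := mul_le_mul_of_nonneg_left h (by positivity : 0 ≤ 2 * γ)
  have e3 : 2 * γ * (γ⁻¹ * ∑ x, μ x * D x ^ 2) = 2 * ∑ x, μ x * D x ^ 2 := by
    field_simp
  have e4 : 2 * γ * (γ / 2 * (γ⁻¹ ^ 2 * ∑ x, μ x * D x ^ 2 + ∑ x, μ x * b x ^ 2)) =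
      ∑ x, μ x * D x ^ 2 + γ ^ 2 * ∑ x, μ x * b x ^ 2 := by
    field_simp
  rw [e3, e4] at h6
  have e5 : ∑ x, μ x * (condE ξ μ T (condE ξ μ T' b) x - condE ξ μ S b x) ^ 2 =
      ∑ x, μ x * D x ^ 2 := rfl
  rw [e5]
  linarith

/-- The system of conditional expectations on coordinates. The spectral hypothesis is a bilinear
correlation bound between the two one-coordinate increments over a common conditioning. -/
noncomputable def cylSystem (ξ : Ω → Fin k → V) (hξ : Function.Injective ξ) (μ : Ω → ℝ)
    (hμ : ∀ x, 0 < μ x) (hsum : ∑ x, μ x = 1) {γ : ℝ} (hγ : 0 < γ)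
    (hcorr : ∀ (S : Finset (Fin k)) (i j : Fin k), i ∉ S → j ∉ S → i ≠ j → ∀ (a b : Ω → ℝ) (x : Ω),
      ∑ y ∈ cyl ξ S x, μ y * ((condE ξ μ (insert i S) a y - condE ξ μ S a y) *
          (condE ξ μ (insert j S) b y - condE ξ μ S b y)) ≤
        γ / 2 * (∑ y ∈ cyl ξ S x, μ y * (condE ξ μ (insert i S) a y - condE ξ μ S a y) ^ 2 +
          ∑ y ∈ cyl ξ S x, μ y * (condE ξ μ (insert j S) b y - condE ξ μ S b y) ^ 2)) :
    CondSystem Ω k γ where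
  μ := μ
  μ_nonneg x := (hμ x).le
  μ_sum := hsum
  P := condE ξ μ
  P_univ f := by
    ext x
    have h : cyl ξ univ x = {x} := by
      ext y
      rw [mem_cyl, mem_singleton]
      exact ⟨fun h => hξ (funext fun j => h j (mem_univ j)), fun h => h ▸ fun _ _ => rfl⟩
    rw [condE_apply, h, sum_singleton, sum_singleton, mul_div_cancel_left₀ _ (hμ x).ne']
  P_empty f x := by
    rw [condE_apply]
    simp [cyl, hsum]
  P_P_of_subset S T f h := condE_condE_of_subset hμ f h
  P_P_of_superset S T f h := condE_condE_of_superset hμ f h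
  P_mul S f g := by
    ext x
    exact condE_mul_of_const (fun y hy => condE_eq_of_mem hy f) g
  P_one := condE_one hμ
  P_nonneg := condE_nonneg hμ
  sum_P S f := sum_mul_condE hμ S f
  γ_nonneg := hγ.le
  near S i j f hi hj hij := sum_sq_condE_condE_sub_le hμ hγ (subset_insert i S)
    (subset_insert j S) (hcorr S i j hi hj hij) f

end Cylinder

section Marginals

lemma sum_agree_image {V : Type*} [Fintype V] [DecidableEq V] {k : ℕ} (A : ℕ → Finset V → ℝ)
    (hA : ∀ m < k, ∀ τ : Finset V, τ.card ≤ m → A m τ = ∑ v, A (m + 1) (insert v τ))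
    (S : Finset (Fin k)) (z : Fin k → V) :
    ∑ y : Fin k → V with ∀ j ∈ S, y j = z j, A k (univ.image y) = A S.card (S.image z) := by
  induction hr : Sᶜ.card generalizing S z with
  | zero =>
    obtain rfl : S = univ := by simpa [card_eq_zero] using hr
    have h : (univ.filter fun y : Fin k → V => ∀ j ∈ univ, y j = z j) = {z} := by
      ext y
      simp [funext_iff]
    rw [h, sum_singleton, card_univ, Fintype.card_fin]
  | succ r ih =>
    obtain ⟨j, hj⟩ : Sᶜ.Nonempty := card_pos.1 (by omega)
    rw [mem_compl] at hj
    have hS : S.card < k := by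
      have := card_compl_add_card S
      rw [Fintype.card_fin] at this
      omega
    rw [hA _ hS _ card_image_le, ← sum_fiberwise _ (fun y : Fin k → V => y j)]
    refine sum_congr rfl fun v _ => ?_
    have h1 := ih (insert j S) (Function.update z j v) (by
      have := card_compl_add_card S
      have := card_compl_add_card (insert j S)
      rw [card_insert_of_notMem hj] at this
      omega)
    have h2 : ∀ i ∈ S, Function.update z j v i = z i := fun i hi =>
      Function.update_of_ne (ne_of_mem_of_not_mem hi hj) _ _
    rw [card_insert_of_notMem hj, image_insert, Function.update_self, image_congr h2] at h1
    rw [← h1]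
    refine sum_congr ?_ fun _ _ => rfl
    ext y
    simp only [mem_filter, mem_univ, true_and, forall_mem_insert, Function.update_self]
    rw [and_comm]
    exact and_congr_right fun _ => forall₂_congr fun i hi => by rw [h2 i hi]

namespace WSC

variable (X : WSC n d)

lemma sum_insert_mem_faces {m : ℕ} {τ : Finset (Fin n)} (hτ : τ.card = m)
    (G : Finset (Fin n) → ℝ) :
    ∑ v, (if insert v τ ∈ X.faces (m + 1) then G (insert v τ) else 0) =
      ∑ σ ∈ (X.faces (m + 1)).filter (τ ⊆ ·), G σ := by
  have hnot : ∀ v, insert v τ ∈ X.faces (m + 1) → v ∉ τ := fun v hv h => by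
    have := X.card_mem _ _ hv
    rw [insert_eq_of_mem h] at this
    omega
  rw [← sum_filter]
  refine sum_bij (fun v _ => insert v τ) ?_ ?_ ?_ fun _ _ => rfl
  · intro v hv
    rw [mem_filter] at hv
    exact mem_filter.2 ⟨hv.2, subset_insert v τ⟩
  · intro v hv u hu h
    have h1 : v ∈ insert u τ := h ▸ mem_insert_self v τ
    exact (mem_insert.1 h1).resolve_right (hnot v (mem_filter.1 hv).2)
  · intro σ hσ
    rw [mem_filter] at hσ
    obtain ⟨v, hv⟩ : (σ \ τ).Nonempty := by
      rw [← card_pos, card_sdiff_of_subset hσ.2, X.card_mem _ _ hσ.1]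
      omega
    rw [mem_sdiff] at hv
    have h : insert v τ = σ := eq_of_subset_of_card_le (insert_subset hv.1 hσ.2) (by
      rw [card_insert_of_notMem hv.2, X.card_mem _ _ hσ.1, hτ])
    exact ⟨v, mem_filter.2 ⟨mem_univ v, h ▸ hσ.1⟩, h⟩

lemma w_eq_sum_insert {m : ℕ} (hm : m < d) {τ : Finset (Fin n)} (hτ : τ.card ≤ m) :
    X.w m τ = 1 / (m + 1 : ℝ) * ∑ v, X.w (m + 1) (insert v τ) := by
  rcases hτ.lt_or_eq with h | h
  · rw [X.w_zero m τ fun h' => h.ne (X.card_mem _ _ h'), sum_eq_zero, mul_zero]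
    refine fun v _ => X.w_zero _ _ fun h' => ?_
    have := X.card_mem _ _ h'
    have := card_insert_le v τ
    omega
  · have h1 : ∀ v, X.w (m + 1) (insert v τ) =
        if insert v τ ∈ X.faces (m + 1) then X.w (m + 1) (insert v τ) else 0 := by
      intro v
      split_ifs with h'
      · rfl
      · exact X.w_zero _ _ h'
    rw [sum_congr rfl fun v _ => h1 v, X.sum_insert_mem_faces h]
    by_cases h2 : τ ∈ X.faces m
    · exact X.w_rec m hm τ h2
    · rw [X.w_zero m τ h2, sum_eq_zero, mul_zero]
      intro σ hσ
      rw [mem_filter] at hσ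
      exact absurd ((X.downward m hm τ).2 ⟨h, σ, hσ⟩) h2

lemma sum_agree_w {k : ℕ} (hk : k ≤ d) (S : Finset (Fin k)) (z : Fin k → Fin n) :
    ∑ y : Fin k → Fin n with ∀ j ∈ S, y j = z j, X.w k (univ.image y) / k.factorial =
      X.w S.card (S.image z) / S.card.factorial := by
  refine sum_agree_image (fun m τ => X.w m τ / m.factorial) (fun m hm τ hτ => ?_) S z
  rw [X.w_eq_sum_insert (hm.trans_le hk) hτ, ← sum_div, Nat.factorial_succ]
  have := Nat.factorial_pos m
  push_cast
  field_simp

lemma filter_superset_eq {k : ℕ} {τ : Finset (Fin n)} (hτ : τ ∈ X.faces k) :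
    (X.faces k).filter (τ ⊆ ·) = {τ} := by
  ext σ
  rw [mem_filter, mem_singleton]
  refine ⟨fun hσ => (eq_of_subset_of_card_le hσ.2 ?_).symm, ?_⟩
  · rw [X.card_mem _ _ hσ.1, X.card_mem _ _ hτ]
  · rintro rfl
    exact ⟨hτ, Subset.rfl⟩

lemma sum_agree_faces {k : ℕ} (h : Finset (Fin n) → ℝ) (S : Finset (Fin k)) (z : Fin k → Fin n)
    (hz : Set.InjOn z S) :
    ∑ y : Fin k → Fin n with ∀ j ∈ S, y j = z j,
        (if univ.image y ∈ X.faces k then h (univ.image y) else 0) =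
      (k - S.card).factorial * ∑ σ ∈ (X.faces k).filter (S.image z ⊆ ·), h σ := by
  have key := sum_agree_image (k := k) (fun m τ => if τ.card = m then
    ((k - m).factorial : ℝ) * ∑ σ ∈ (X.faces k).filter (τ ⊆ ·), h σ else 0)
    (fun m hm τ hτ => ?_) S z
  · simp only [card_image_of_injOn hz, if_true] at key
    rw [← key]
    refine sum_congr rfl fun y _ => ?_
    rw [Nat.sub_self, Nat.factorial_zero, Nat.cast_one, one_mul]
    by_cases hy : univ.image y ∈ X.faces k
    · rw [if_pos hy, if_pos (X.card_mem _ _ hy), X.filter_superset_eq hy, sum_singleton]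
    · rw [if_neg hy]
      split_ifs with hc
      · refine (sum_eq_zero fun σ hσ => ?_).symm
        rw [mem_filter] at hσ
        have := eq_of_subset_of_card_le hσ.2 (by rw [X.card_mem _ _ hσ.1, hc])
        exact absurd (this ▸ hσ.1) hy
      · rfl
  · have hval : ∀ v, (insert v τ).card = m + 1 ↔ (τ.card = m ∧ v ∉ τ) := by
      intro v
      by_cases hv : v ∈ τ
      · rw [insert_eq_of_mem hv]
        exact ⟨fun h => by omega, fun h => absurd hv h.2⟩
      · rw [card_insert_of_notMem hv]
        simp [hv]
    simp only [hval]
    split_ifs with hc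
    swap
    · simp [hc]
    simp only [hc, true_and]
    obtain ⟨r, rfl⟩ : ∃ r, k = m + 1 + r := ⟨k - (m + 1), by omega⟩
    rw [show m + 1 + r - m = r + 1 by omega, show m + 1 + r - (m + 1) = r by omega,
      Nat.factorial_succ, ← sum_filter, ← mul_sum, mul_comm (r + 1), Nat.cast_mul, mul_assoc]
    congr 1
    rw [sum_filter, sum_congr rfl fun v _ => sum_filter (insert v τ ⊆ ·) h, sum_comm, mul_sum]
    refine sum_congr rfl fun σ hσ => ?_
    rw [← sum_filter, sum_const, nsmul_eq_mul]
    by_cases hs : τ ⊆ σ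
    · rw [if_pos hs]
      congr 2
      have he : (univ.filter (· ∉ τ)).filter (fun v => insert v τ ⊆ σ) = σ \ τ := by
        ext v
        simp only [mem_filter, mem_univ, true_and, insert_subset_iff, mem_sdiff]
        tauto
      rw [he, card_sdiff_of_subset hs, X.card_mem _ _ hσ]
      omega
    · rw [if_neg hs, filter_false_of_mem]
      · simp
      · exact fun v _ h => hs ((subset_insert v τ).trans h)

end WSC

end Marginals

section Expansion

variable (X : WSC n d)

lemma edgeW_nonneg (i : ℕ) (s : Finset (Fin n)) (u v : Fin n) : 0 ≤ edgeW X i s u v := by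
  unfold edgeW
  split_ifs
  · exact X.w_nonneg _ _
  · exact le_rfl

lemma edgeW_comm (i : ℕ) (s : Finset (Fin n)) (u v : Fin n) :
    edgeW X i s u v = edgeW X i s v u := by
  unfold edgeW
  rw [Finset.insert_comm u v s]
  refine if_congr ?_ rfl rfl
  rw [ne_comm]
  tauto

lemma edgeW_eq_w {i : ℕ} {s : Finset (Fin n)} (hs : s.card = i) (u v : Fin n) :
    edgeW X i s u v = X.w (i + 2) (insert u (insert v s)) := by
  unfold edgeW
  split_ifs with h
  · rfl
  · refine (X.w_zero _ _ fun h' => h ?_).symm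
    have hc := X.card_mem _ _ h'
    have h1 := card_insert_le u (insert v s)
    have h2 := card_insert_le v s
    have hv : v ∉ s := fun hv => by
      rw [insert_eq_of_mem hv] at hc h1
      omega
    have hu : u ∉ insert v s := fun hu => by
      rw [insert_eq_of_mem hu] at hc
      omega
    rw [mem_insert, not_or] at hu
    exact ⟨hu.1, hu.2, hv, h'⟩

variable {X}

lemma IsLSE.mono {γ γ' : ℝ} (hX : IsLSE X γ) (h : γ ≤ γ') : IsLSE X γ' :=
  fun i hi s hs f hf => (hX i hi s hs f hf).trans <| mul_le_mul_of_nonneg_right h <|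
    sum_nonneg fun u _ => mul_nonneg (sum_nonneg fun v _ => edgeW_nonneg X i s u v) (sq_nonneg _)

lemma IsLSE.sum_edgeW_mul_le {γ : ℝ} (hX : IsLSE X γ) {i : ℕ} (hi : i + 2 ≤ d)
    {s : Finset (Fin n)} (hs : s ∈ X.faces i) {p q : Fin n → ℝ}
    (hp : ∑ u, vertW X i s u * p u = 0) (hq : ∑ u, vertW X i s u * q u = 0) :
    ∑ u, ∑ v, edgeW X i s u v * (p u * q v) ≤
      γ / 2 * (∑ u, vertW X i s u * p u ^ 2 + ∑ u, vertW X i s u * q u ^ 2) := by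
  have h1 := (abs_le.1 (hX i hi s hs (p + q) (by
    simp only [Pi.add_apply, mul_add, sum_add_distrib, hp, hq, add_zero]))).2
  have h2 := (abs_le.1 (hX i hi s hs (p - q) (by
    simp only [Pi.sub_apply, mul_sub, sum_sub_distrib, hp, hq, sub_zero]))).1
  have hsymm : ∑ u, ∑ v, edgeW X i s u v * (q u * p v) =
      ∑ u, ∑ v, edgeW X i s u v * (p u * q v) := by
    rw [sum_comm]
    refine sum_congr rfl fun u _ => sum_congr rfl fun v _ => ?_
    rw [edgeW_comm]
    ring
  have h3 : ∑ u, ∑ v, edgeW X i s u v * (p + q) u * (p + q) v -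
      ∑ u, ∑ v, edgeW X i s u v * (p - q) u * (p - q) v =
      2 * ∑ u, ∑ v, edgeW X i s u v * (p u * q v) +
      2 * ∑ u, ∑ v, edgeW X i s u v * (q u * p v) := by
    simp only [mul_sum, ← sum_sub_distrib, ← sum_add_distrib, Pi.add_apply, Pi.sub_apply]
    exact sum_congr rfl fun u _ => sum_congr rfl fun v _ => by ring
  have h4 : ∑ u, vertW X i s u * (p + q) u ^ 2 + ∑ u, vertW X i s u * (p - q) u ^ 2 =
      2 * (∑ u, vertW X i s u * p u ^ 2 + ∑ u, vertW X i s u * q u ^ 2) := by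
    simp only [mul_sum, ← sum_add_distrib, Pi.add_apply, Pi.sub_apply]
    exact sum_congr rfl fun u _ => by ring
  have h5 := congrArg (γ * ·) h4
  simp only [mul_add] at h5
  linarith

end Expansion

section Sequences

namespace WSC

variable (X : WSC n d)

lemma le_of_mem_faces {k : ℕ} {σ : Finset (Fin n)} (hσ : σ ∈ X.faces k) : k ≤ d := by
  by_contra! h
  rw [X.empty_levels k h] at hσ
  simp at hσ

lemma mem_faces_of_subset {k : ℕ} {σ τ : Finset (Fin n)} (hσ : σ ∈ X.faces k) (h : τ ⊆ σ) :
    τ ∈ X.faces τ.card := by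
  induction k generalizing σ with
  | zero =>
    have h0 := X.card_mem _ _ hσ
    rw [card_eq_zero] at h0
    subst h0
    rw [subset_empty.1 h]
    simpa using hσ
  | succ k ih =>
    have hc := X.card_mem _ _ hσ
    rcases (card_le_card h).lt_or_eq with h1 | h1
    · obtain ⟨t, ht1, ht2, ht3⟩ := exists_subsuperset_card_eq h (n := k) (by omega) (by omega)
      exact ih ((X.downward k (X.le_of_mem_faces hσ) t).2 ⟨ht3, σ, hσ, ht2⟩) ht1
    · rw [eq_of_subset_of_card_le h h1.ge, hc]
      exact hσ

lemma faces_nonempty {k : ℕ} (hk : k ≤ d) : (X.faces k).Nonempty := by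
  obtain ⟨σ, hσ⟩ := X.top_nonempty
  obtain ⟨τ, h1, h2⟩ := exists_subset_card_eq (hk.trans (X.card_mem _ _ hσ).ge)
  exact ⟨τ, h2 ▸ X.mem_faces_of_subset hσ h1⟩

/-- The orderings of the `k`-faces. -/
abbrev Seq (k : ℕ) := {x : Fin k → Fin n // univ.image x ∈ X.faces k}

variable {X} {k : ℕ}

lemma Seq.injective (x : X.Seq k) : Function.Injective x.1 := by
  have h : (univ.image x.1).card = (univ : Finset (Fin k)).card := by
    rw [X.card_mem _ _ x.2, card_univ, Fintype.card_fin]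
  simpa using card_image_iff.1 h

lemma exists_seq {σ : Finset (Fin n)} (hσ : σ ∈ X.faces k) :
    ∃ x : X.Seq k, univ.image x.1 = σ := by
  have h : univ.image (σ.orderEmbOfFin (X.card_mem _ _ hσ)) = σ := by
    simp
  exact ⟨⟨σ.orderEmbOfFin (X.card_mem _ _ hσ), h.symm ▸ hσ⟩, h⟩

lemma Seq.image_mem (x : X.Seq k) (S : Finset (Fin k)) : S.image x.1 ∈ X.faces S.card := by
  have h := X.mem_faces_of_subset x.2 (image_subset_image (subset_univ S))
  rwa [card_image_of_injective S x.injective] at h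

/-- The law of a uniformly random ordering of a random face. -/
noncomputable def seqWt (x : X.Seq k) : ℝ := X.w k (univ.image x.1) / k.factorial

lemma seqWt_pos (x : X.Seq k) : 0 < seqWt x :=
  div_pos (X.w_pos _ _ x.2) (by exact_mod_cast Nat.factorial_pos k)

lemma sum_cyl_seq (F : (Fin k → Fin n) → ℝ) (S : Finset (Fin k)) (x : X.Seq k) :
    ∑ y ∈ cyl Subtype.val S x, F y.1 = ∑ y : Fin k → Fin n with ∀ j ∈ S, y j = x.1 j,
      if univ.image y ∈ X.faces k then F y else 0 := by
  rw [cyl, ← sum_filter (fun y : Fin k → Fin n => univ.image y ∈ X.faces k), filter_filter]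
  refine sum_bij (fun y _ => y.1) ?_ ?_ ?_ fun _ _ => rfl
  · intro y hy
    simpa [y.2] using hy
  · exact fun y _ z _ h => Subtype.ext h
  · intro y hy
    simp only [mem_filter, mem_univ, true_and] at hy
    exact ⟨⟨y, hy.2⟩, by simpa using hy.1, rfl⟩

lemma sum_cyl_seqWt_image (f : Cf n) (S : Finset (Fin k)) (x : X.Seq k) :
    ∑ y ∈ cyl Subtype.val S x, seqWt y * f (univ.image y.1) =
      (k - S.card).factorial / k.factorial *
        ∑ σ ∈ (X.faces k).filter (S.image x.1 ⊆ ·), X.w k σ * f σ := by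
  rw [show ∑ y ∈ cyl Subtype.val S x, seqWt y * f (univ.image y.1) = _ from
    sum_cyl_seq (fun y => X.w k (univ.image y) / k.factorial * f (univ.image y)) S x,
    X.sum_agree_faces (fun σ => X.w k σ / k.factorial * f σ) S x.1 x.injective.injOn,
    div_mul_eq_mul_div, mul_div_assoc, sum_div]
  congr 1
  exact sum_congr rfl fun σ _ => by ring

lemma condE_image (f : Cf n) (S : Finset (Fin k)) (x : X.Seq k) :
    condE Subtype.val seqWt S (fun y : X.Seq k => f (univ.image y.1)) x =
      linkMean X k (S.image x.1) f := by
  have h := sum_cyl_seqWt_image (fun _ => 1) S x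
  simp only [mul_one] at h
  have : ((k - S.card).factorial : ℝ) / k.factorial ≠ 0 := by positivity
  rw [condE_apply, sum_cyl_seqWt_image, h, linkMean, mul_div_mul_left _ _ this]

lemma sum_seqWt_image (hk : k ≤ d) (f : Cf n) :
    ∑ y : X.Seq k, seqWt y * f (univ.image y.1) = EE X k f := by
  obtain ⟨σ, hσ⟩ := X.faces_nonempty hk
  obtain ⟨x, -⟩ := exists_seq hσ
  have h := sum_cyl_seqWt_image f ∅ x
  have : (k.factorial : ℝ) ≠ 0 := by positivity
  simpa [cyl, div_self this, EE] using h

lemma sum_seqWt_eq (hk : k ≤ d) : ∑ y : X.Seq k, seqWt y = X.w 0 ∅ := by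
  obtain ⟨σ, hσ⟩ := X.faces_nonempty hk
  obtain ⟨x, -⟩ := exists_seq hσ
  have h := sum_cyl_seq (fun y => X.w k (univ.image y) / k.factorial) ∅ x
  have h2 := X.sum_agree_w hk ∅ x.1
  simp only [cyl, notMem_empty, false_imp_iff, implies_true, filter_true, card_empty,
    Nat.factorial_zero, Nat.cast_one, div_one, image_empty] at h h2
  rw [← h2]
  refine h.trans (sum_congr rfl fun y _ => ?_)
  split_ifs with hy
  · rfl
  · rw [X.w_zero _ _ hy, zero_div]

lemma sum_seqWt (hk : k ≤ d) : ∑ y : X.Seq k, seqWt y = 1 := by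
  have h := sum_seqWt_image (X := X) le_rfl (fun _ => 1)
  simp only [mul_one, EE, X.w_top_sum] at h
  rw [sum_seqWt_eq hk, ← h, sum_seqWt_eq le_rfl]

lemma sum_cyl_seqWt_pair (hk : k ≤ d) {S : Finset (Fin k)} {i j : Fin k} (hi : i ∉ S)
    (hj : j ∉ S) (hij : i ≠ j) (H : Fin n → Fin n → ℝ) (x : X.Seq k) :
    ∑ y ∈ cyl Subtype.val S x, seqWt y * H (y.1 i) (y.1 j) =
      (∑ u, ∑ v, edgeW X S.card (S.image x.1) u v * H u v) / (S.card + 2).factorial := by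
  have h1 : ∀ y : Fin k → Fin n, (if univ.image y ∈ X.faces k then
      X.w k (univ.image y) / k.factorial * H (y i) (y j) else 0) =
      X.w k (univ.image y) / k.factorial * H (y i) (y j) := by
    intro y
    split_ifs with hy
    · rfl
    · rw [X.w_zero _ _ hy, zero_div, zero_mul]
  rw [show ∑ y ∈ cyl Subtype.val S x, seqWt y * H (y.1 i) (y.1 j) = _ from
    sum_cyl_seq (fun y => X.w k (univ.image y) / k.factorial * H (y i) (y j)) S x,
    sum_congr rfl fun y _ => h1 y, ← sum_fiberwise _ (fun y : Fin k → Fin n => y i), sum_div]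
  refine sum_congr rfl fun u _ => ?_
  rw [← sum_fiberwise _ (fun y : Fin k → Fin n => y j), sum_div]
  refine sum_congr rfl fun v _ => ?_
  have hji : j ∉ insert i S := by simp [hj, hij.symm]
  set z := Function.update (Function.update x.1 i u) j v with hz
  have hzj : z j = v := by simp [hz]
  have hzi : z i = u := by simp [hz, hij]
  have hzS : ∀ l ∈ S, z l = x.1 l := fun l hl => by
    rw [hz, Function.update_of_ne (ne_of_mem_of_not_mem hl hj),
      Function.update_of_ne (ne_of_mem_of_not_mem hl hi)]
  have h2 := X.sum_agree_w hk (insert j (insert i S)) z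
  rw [card_insert_of_notMem hji, card_insert_of_notMem hi, image_insert, image_insert, hzj, hzi,
    image_congr hzS, ← edgeW_eq_w X (card_image_of_injective S x.injective)] at h2
  rw [mul_div_right_comm, edgeW_comm]
  refine Eq.trans ?_ (congrArg (· * H u v) h2)
  rw [sum_mul]
  refine sum_congr ?_ fun y hy => ?_
  · ext y
    simp only [mem_filter, mem_univ, true_and, forall_mem_insert, hzi, hzj]
    have : (∀ l ∈ S, y l = z l) ↔ ∀ l ∈ S, y l = x.1 l :=
      forall₂_congr fun l hl => by rw [hzS l hl]
    rw [this]
    tauto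
  · simp only [mem_filter, mem_univ, true_and, forall_mem_insert, hzi, hzj] at hy
    rw [hy.1, hy.2.1]

lemma exists_condE_sub_eq {V : Type*} [DecidableEq V] {Ω : Type*} [Fintype Ω]
    (ξ : Ω → Fin k → V) (μ : Ω → ℝ) (S : Finset (Fin k)) (i : Fin k) (a : Ω → ℝ) (x : Ω) :
    ∃ p : V → ℝ, ∀ y ∈ cyl ξ S x, condE ξ μ (insert i S) a y - condE ξ μ S a y = p (ξ y i) := by
  classical
  refine ⟨fun v => if h : ∃ y ∈ cyl ξ S x, ξ y i = v then
    condE ξ μ (insert i S) a h.choose - condE ξ μ S a h.choose else 0, fun y hy => ?_⟩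
  have h : ∃ z ∈ cyl ξ S x, ξ z i = ξ y i := ⟨y, hy, rfl⟩
  simp only [dif_pos h]
  obtain ⟨h1, h2⟩ := h.choose_spec
  generalize h.choose = z at h1 h2 ⊢
  rw [← cyl_eq_of_mem ξ hy] at h1
  have h3 : z ∈ cyl ξ (insert i S) y := by
    rw [mem_cyl] at h1 ⊢
    exact (forall_mem_insert _ _ _).2 ⟨h2, h1⟩
  rw [condE_eq_of_mem h1, condE_eq_of_mem h3]

lemma seq_corr_le (hk : k ≤ d) {γ : ℝ} (hX : IsLSE X γ) {S : Finset (Fin k)} {i j : Fin k}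
    (hi : i ∉ S) (hj : j ∉ S) (hij : i ≠ j) (a b : X.Seq k → ℝ) (x : X.Seq k) :
    ∑ y ∈ cyl Subtype.val S x, seqWt y *
        ((condE Subtype.val seqWt (insert i S) a y - condE Subtype.val seqWt S a y) *
          (condE Subtype.val seqWt (insert j S) b y - condE Subtype.val seqWt S b y)) ≤
      γ / 2 * (∑ y ∈ cyl Subtype.val S x, seqWt y *
          (condE Subtype.val seqWt (insert i S) a y - condE Subtype.val seqWt S a y) ^ 2 +
        ∑ y ∈ cyl Subtype.val S x, seqWt y *
          (condE Subtype.val seqWt (insert j S) b y - condE Subtype.val seqWt S b y) ^ 2) := by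
  obtain ⟨p, hp⟩ := exists_condE_sub_eq Subtype.val seqWt S i a x
  obtain ⟨q, hq⟩ := exists_condE_sub_eq Subtype.val seqWt S j b x
  have mean_zero : ∀ (l : Fin k) (c : X.Seq k → ℝ), ∑ y ∈ cyl Subtype.val S x, seqWt y *
      (condE Subtype.val seqWt (insert l S) c y - condE Subtype.val seqWt S c y) = 0 := by
    intro l c
    simp only [mul_sub, sum_sub_distrib]
    rw [sum_cyl_condE seqWt_pos c (subset_insert l S), sum_cyl_condE seqWt_pos c Subset.rfl,
      sub_self]
  have hp0 := mean_zero i a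
  have hq0 := mean_zero j b
  rw [sum_congr rfl fun y hy => by rw [hp y hy]] at hp0
  rw [sum_congr rfl fun y hy => by rw [hq y hy]] at hq0
  have sum_sq : ∀ {u v : X.Seq k → ℝ}, (∀ y ∈ cyl Subtype.val S x, u y = v y) →
      ∑ y ∈ cyl Subtype.val S x, seqWt y * u y ^ 2 =
        ∑ y ∈ cyl Subtype.val S x, seqWt y * v y ^ 2 :=
    fun h => sum_congr rfl fun y hy => by rw [h y hy]
  rw [sum_congr rfl fun y hy => by rw [hp y hy, hq y hy],
    sum_sq hp, sum_sq hq]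
  have law := fun H => sum_cyl_seqWt_pair hk hi hj hij H x
  have hfac : (0 : ℝ) < (S.card + 2).factorial := by exact_mod_cast Nat.factorial_pos _
  have left : ∀ r : Fin n → ℝ, ∑ u, ∑ v, edgeW X S.card (S.image x.1) u v * r u =
      ∑ u, vertW X S.card (S.image x.1) u * r u := fun r => by
    simp only [vertW, sum_mul]
  have right : ∀ r : Fin n → ℝ, ∑ u, ∑ v, edgeW X S.card (S.image x.1) u v * r v =
      ∑ u, vertW X S.card (S.image x.1) u * r u := fun r => by
    rw [sum_comm, ← left]
    exact sum_congr rfl fun u _ => sum_congr rfl fun v _ => by rw [edgeW_comm]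
  rw [law fun u _ => p u, left, div_eq_zero_iff, or_iff_left hfac.ne'] at hp0
  rw [law fun _ v => q v, right, div_eq_zero_iff, or_iff_left hfac.ne'] at hq0
  have hcard : S.card + 2 ≤ k := by
    have h := card_le_univ (insert j (insert i S))
    rw [card_insert_of_notMem (by simp [hj, hij.symm]), card_insert_of_notMem hi,
      Fintype.card_fin] at h
    omega
  have key := hX.sum_edgeW_mul_le (hcard.trans hk) (x.image_mem S) hp0 hq0
  rw [law fun u v => p u * q v, law fun u _ => p u ^ 2, law fun _ v => q v ^ 2,
    left fun u => p u ^ 2, right fun v => q v ^ 2, ← add_div, ← mul_div_assoc]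
  exact div_le_div_of_nonneg_right key hfac.le

variable (X) in
/-- The conditional expectations of a random ordering of a random face. -/
noncomputable def seqSystem (hk : k ≤ d) {γ : ℝ} (hγ : 0 < γ) (hX : IsLSE X γ) :
    CondSystem (X.Seq k) k γ :=
  cylSystem Subtype.val Subtype.val_injective seqWt seqWt_pos (sum_seqWt hk) hγ
    fun _ _ _ hi hj hij a b x => seq_corr_le hk hX hi hj hij a b x

end WSC

end Sequences

section Levels

namespace WSC

variable (X : WSC n d) {k : ℕ}

lemma sum_faces_sum_faces {m : ℕ} (hm : m < k) {τ : Finset (Fin n)} (hτ : τ.card = m)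
    (h : Finset (Fin n) → ℝ) :
    ∑ σ ∈ (X.faces (m + 1)).filter (τ ⊆ ·), ∑ ρ ∈ (X.faces k).filter (σ ⊆ ·), h ρ =
      (k - m : ℝ) * ∑ ρ ∈ (X.faces k).filter (τ ⊆ ·), h ρ := by
  have hterm : ∀ v, (if insert v τ ∈ X.faces (m + 1) then
      ∑ ρ ∈ (X.faces k).filter (insert v τ ⊆ ·), h ρ else 0) =
      ∑ ρ ∈ (X.faces k).filter (τ ⊆ ·), if v ∈ ρ \ τ then h ρ else 0 := by
    intro v
    rw [← sum_filter, filter_filter]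
    split_ifs with hv
    · have hvτ : v ∉ τ := fun h' => by
        have := X.card_mem _ _ hv
        rw [insert_eq_of_mem h'] at this
        omega
      refine sum_congr ?_ fun _ _ => rfl
      ext ρ
      simp only [mem_filter, insert_subset_iff, mem_sdiff]
      tauto
    · rw [filter_false_of_mem, sum_empty]
      rintro ρ hρ ⟨h1, h2⟩
      rw [mem_sdiff] at h2
      apply hv
      have := X.mem_faces_of_subset hρ (insert_subset h2.1 h1)
      rwa [card_insert_of_notMem h2.2, hτ] at this
  rw [← X.sum_insert_mem_faces hτ, sum_congr rfl fun v _ => hterm v, sum_comm, mul_sum]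
  refine sum_congr rfl fun ρ hρ => ?_
  rw [mem_filter] at hρ
  rw [← sum_filter, sum_const, nsmul_eq_mul, filter_univ_mem, card_sdiff_of_subset hρ.2,
    X.card_mem _ _ hρ.1, hτ, Nat.cast_sub hm.le]

lemma exists_sum_w_eq_mul (hk : k ≤ d) {j : ℕ} (hj : j ≤ k) : ∃ c : ℝ, 0 < c ∧
    ∀ τ ∈ X.faces (k - j), ∑ ρ ∈ (X.faces k).filter (τ ⊆ ·), X.w k ρ = c * X.w (k - j) τ := by
  induction j with
  | zero =>
    refine ⟨1, one_pos, fun τ hτ => ?_⟩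
    rw [Nat.sub_zero] at hτ
    rw [X.filter_superset_eq hτ, sum_singleton, one_mul, Nat.sub_zero]
  | succ j ih =>
    obtain ⟨c, hc, h⟩ := ih (by omega)
    obtain ⟨m, rfl⟩ : ∃ m, k = m + (j + 1) := ⟨k - (j + 1), by omega⟩
    rw [show m + (j + 1) - j = m + 1 by omega] at h
    rw [Nat.add_sub_cancel]
    refine ⟨c * (m + 1) / (j + 1), by positivity, fun τ hτ => ?_⟩
    have h1 := X.sum_faces_sum_faces (k := m + (j + 1)) (by omega) (X.card_mem _ _ hτ)
      (X.w (m + (j + 1)))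
    rw [sum_congr rfl fun σ hσ => h σ (mem_filter.1 hσ).1, ← mul_sum] at h1
    rw [X.w_rec m (by omega) τ hτ]
    push_cast at h1
    have h2 : (m + (j + 1) - m : ℝ) = j + 1 := by ring
    rw [h2] at h1
    field_simp
    linarith

lemma Dc_eq_linkMean (hk : k ≤ d) (f : Cf n) {j : ℕ} (hj : j ≤ k) {τ : Finset (Fin n)}
    (hτ : τ ∈ X.faces (k - j)) : Dc X k j f τ = linkMean X k τ f := by
  induction j generalizing τ with
  | zero =>
    rw [Nat.sub_zero] at hτ
    rw [linkMean, X.filter_superset_eq hτ, sum_singleton, sum_singleton,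
      mul_div_cancel_left₀ _ (X.w_pos _ _ hτ).ne']
    rfl
  | succ j ih =>
    obtain ⟨c, hc, h⟩ := X.exists_sum_w_eq_mul hk (j := j) (by omega)
    obtain ⟨m, rfl⟩ : ∃ m, k = m + (j + 1) := ⟨k - (j + 1), by omega⟩
    rw [Nat.add_sub_cancel] at hτ
    have e : m + (j + 1) - j = m + 1 := by omega
    rw [e] at h
    have hs := X.sum_faces_sum_faces (k := m + (j + 1)) (by omega) (X.card_mem _ _ hτ)
    have h1 : ∀ σ ∈ (X.faces (m + 1)).filter (τ ⊆ ·), X.w (m + 1) σ * Dc X (m + (j + 1)) j f σ =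
        c⁻¹ * ∑ ρ ∈ (X.faces (m + (j + 1))).filter (σ ⊆ ·), X.w (m + (j + 1)) ρ * f ρ := by
      intro σ hσ
      have hσ1 := (mem_filter.1 hσ).1
      have := X.w_pos _ _ hσ1
      rw [ih (by omega) (by rwa [e]), linkMean, h σ hσ1]
      field_simp
    have h2 : ∀ σ ∈ (X.faces (m + 1)).filter (τ ⊆ ·), X.w (m + 1) σ =
        c⁻¹ * ∑ ρ ∈ (X.faces (m + (j + 1))).filter (σ ⊆ ·), X.w (m + (j + 1)) ρ := by
      intro σ hσ
      rw [h σ (mem_filter.1 hσ).1]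
      field_simp
    rw [Dc, Dop, Nat.add_sub_cancel, sum_congr rfl h1, sum_congr rfl h2, ← mul_sum, ← mul_sum,
      hs, hs, mul_div_mul_left _ _ (inv_ne_zero hc.ne'), mul_div_mul_left, linkMean]
    push_cast
    have h3 : (m + (j + 1) - m : ℝ) = j + 1 := by ring
    rw [h3]
    positivity

lemma sum_powersetCard_erase {α : Type*} [DecidableEq α] {t : ℕ} {τ : Finset α}
    (hτ : τ.card = t + 1) (G : Finset α → ℝ) :
    ∑ σ ∈ powersetCard t τ, G σ = ∑ v ∈ τ, G (τ.erase v) := by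
  symm
  refine sum_bij (fun v _ => τ.erase v) ?_ ?_ ?_ fun _ _ => rfl
  · intro v hv
    rw [mem_powersetCard, card_erase_of_mem hv, hτ]
    exact ⟨erase_subset v τ, rfl⟩
  · exact fun v hv u _ h => (erase_inj τ hv).1 h
  · intro σ hσ
    rw [mem_powersetCard] at hσ
    obtain ⟨v, hv⟩ : (τ \ σ).Nonempty := by
      rw [← card_pos, card_sdiff_of_subset hσ.1]
      omega
    rw [mem_sdiff] at hv
    refine ⟨v, hv.1, (eq_of_subset_of_card_le (subset_erase.2 ⟨hσ.1, hv.2⟩) ?_).symm⟩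
    rw [card_erase_of_mem hv.1]
    omega

lemma sum_powersetCard_powersetCard {α : Type*} [DecidableEq α] {j m : ℕ} {τ : Finset α}
    (hτ : τ.card = j + m + 1) (h : Finset α → ℝ) :
    ∑ σ ∈ powersetCard (j + m) τ, ∑ ρ ∈ powersetCard j σ, h ρ =
      (m + 1 : ℝ) * ∑ ρ ∈ powersetCard j τ, h ρ := by
  rw [sum_powersetCard_erase hτ]
  have h1 : ∀ v ∈ τ, ∑ ρ ∈ powersetCard j (τ.erase v), h ρ =
      ∑ ρ ∈ powersetCard j τ, if v ∉ ρ then h ρ else 0 := by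
    intro v _
    rw [← sum_filter]
    refine sum_congr ?_ fun _ _ => rfl
    ext ρ
    simp only [mem_powersetCard, mem_filter, subset_erase]
    tauto
  rw [sum_congr rfl h1, sum_comm, mul_sum]
  refine sum_congr rfl fun ρ hρ => ?_
  rw [mem_powersetCard] at hρ
  rw [← sum_filter, sum_const, nsmul_eq_mul, ← sdiff_eq_filter, card_sdiff_of_subset hρ.1, hτ, hρ.2,
    show j + m + 1 - j = m + 1 by omega]
  push_cast
  rfl

lemma choose_mul_Uc (h : Cf n) (j m : ℕ) {τ : Finset (Fin n)} (hτ : τ ∈ X.faces (j + m)) :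
    ((j + m).choose j : ℝ) * Uc X j m h τ = ∑ σ ∈ powersetCard j τ, h σ := by
  induction m generalizing τ with
  | zero =>
    have hc : τ.card = j := X.card_mem _ _ hτ
    have he : powersetCard j τ = {τ} := hc ▸ powersetCard_self τ
    rw [he, sum_singleton]
    simp [Uc]
  | succ m ih =>
    have hc := X.card_mem _ _ hτ
    have he : (X.faces (j + m)).filter (· ⊆ τ) = powersetCard (j + m) τ := by
      ext σ
      rw [mem_filter, mem_powersetCard, and_comm]
      refine and_congr_right fun hs => ⟨X.card_mem _ _, ?_⟩
      intro hσ
      exact hσ ▸ X.mem_faces_of_subset hτ hs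
    have hch : ((j + m).choose j : ℝ) * (j + m + 1) = (j + (m + 1)).choose j * (m + 1) := by
      have := Nat.choose_mul_succ_eq (j + m) j
      rw [show j + m + 1 - j = m + 1 by omega] at this
      exact_mod_cast this
    have hih : ∀ σ ∈ powersetCard (j + m) τ, Uc X j m h σ =
        ((j + m).choose j : ℝ)⁻¹ * ∑ ρ ∈ powersetCard j σ, h ρ := by
      intro σ hσ
      rw [← he, mem_filter] at hσ
      have : ((j + m).choose j : ℝ) ≠ 0 := by
        exact_mod_cast (Nat.choose_pos (Nat.le_add_right j m)).ne'
      rw [← ih hσ.1, inv_mul_cancel_left₀ this]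
    rw [Uc, Uop, he, sum_congr rfl hih, ← mul_sum, sum_powersetCard_powersetCard hc]
    have h0 : ((j + m).choose j : ℝ) ≠ 0 := by
      exact_mod_cast (Nat.choose_pos (Nat.le_add_right j m)).ne'
    have h1 : (j + m + 1 : ℝ) ≠ 0 := by positivity
    push_cast
    field_simp
    rw [← hch]
    ring

lemma choose_mul_Uc_sub (h : Cf n) {j i : ℕ} (hj : j ≤ i) {τ : Finset (Fin n)}
    (hτ : τ ∈ X.faces i) :
    (i.choose j : ℝ) * Uc X j (i - j) h τ = ∑ σ ∈ powersetCard j τ, h σ := by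
  obtain ⟨m, rfl⟩ := Nat.exists_eq_add_of_le hj
  rw [Nat.add_sub_cancel_left]
  exact X.choose_mul_Uc h j m hτ

lemma gLevel_eq_altSum (hk : k ≤ d) (f : Cf n) {i : ℕ} (hi : i ≤ k) {τ : Finset (Fin n)}
    (hτ : τ ∈ X.faces i) : gLevel X k f i τ = altSum (fun R => linkMean X k R f) τ := by
  induction i using Nat.strong_induction_on generalizing τ with
  | _ i ih =>
    have hc := X.card_mem _ _ hτ
    have h1 := sum_altSum (fun R => linkMean X k R f) τ
    rw [sum_powerset, hc, sum_range_succ] at h1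
    have he : powersetCard i τ = {τ} := hc ▸ powersetCard_self τ
    rw [he, sum_singleton] at h1
    rw [gLevel, Pi.sub_apply, Finset.sum_apply,
      X.Dc_eq_linkMean hk f (Nat.sub_le k i) (by rwa [Nat.sub_sub_self hi]), ← h1,
      sum_attach (range i) fun j => ((i.choose j : ℝ) • Uc X j (i - j) (gLevel X k f j)) τ,
      sub_eq_iff_eq_add, add_comm]
    congr 1
    refine sum_congr rfl fun j hj => ?_
    rw [mem_range] at hj
    rw [Pi.smul_apply, smul_eq_mul, X.choose_mul_Uc_sub _ hj.le hτ]
    refine sum_congr rfl fun σ hσ => ?_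
    rw [mem_powersetCard] at hσ
    exact (ih j hj (hj.le.trans hi) (hσ.2 ▸ X.mem_faces_of_subset hτ hσ.1)).symm

lemma sum_powersetCard_image {α β : Type*} [DecidableEq α] [DecidableEq β] {e : α → β}
    (he : Function.Injective e) (j : ℕ) (S : Finset α) (G : Finset β → ℝ) :
    ∑ σ ∈ powersetCard j (S.image e), G σ = ∑ T ∈ powersetCard j S, G (T.image e) := by
  have h := powersetCard_map ⟨e, he⟩ j S
  rw [map_eq_image] at h
  simp only [Function.Embedding.coeFn_mk] at h
  rw [h, sum_map]
  refine sum_congr rfl fun T _ => ?_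
  simp [map_eq_image]

lemma altSum_image {α β : Type*} [DecidableEq α] [DecidableEq β] {e : α → β}
    (he : Function.Injective e) (F : Finset β → ℝ) (T : Finset α) :
    altSum F (T.image e) = altSum (fun R => F (R.image e)) T := by
  rw [altSum, altSum, powerset_image, sum_image ((image_injective he).injOn)]
  refine sum_congr rfl fun R _ => ?_
  rw [← image_sdiff _ _ he, card_image_of_injective _ he]

variable {X} {γ : ℝ} (hγ : 0 < γ) (hX : IsLSE X γ)

lemma seqSystem_P (hk : k ≤ d) (f : Cf n) (S : Finset (Fin k)) (x : X.Seq k) :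
    (X.seqSystem hk hγ hX).P S (fun y => f (univ.image y.1)) x = linkMean X k (S.image x.1) f :=
  condE_image f S x

lemma seqSystem_E (hk : k ≤ d) (f : Cf n) :
    (X.seqSystem hk hγ hX).E (fun y => f (univ.image y.1)) = EE X k f :=
  sum_seqWt_image hk f

lemma seqSystem_comp (hk : k ≤ d) (f : Cf n) (T : Finset (Fin k)) (x : X.Seq k) :
    (X.seqSystem hk hγ hX).comp (fun y => f (univ.image y.1)) T x =
      altSum (fun R => linkMean X k R f) (T.image x.1) := by
  rw [CondSystem.comp_apply, altSum_image x.injective]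
  simp only [seqSystem_P]

lemma fLevel_image (hk : k ≤ d) (f : Cf n) {j : ℕ} (hj : j ≤ k) (x : X.Seq k) :
    fLevel X k f j (univ.image x.1) = ∑ T ∈ powersetCard j univ,
      (X.seqSystem hk hγ hX).comp (fun y => f (univ.image y.1)) T x := by
  rw [fLevel, Pi.smul_apply, smul_eq_mul, X.choose_mul_Uc_sub _ hj x.2,
    sum_powersetCard_image x.injective]
  refine sum_congr rfl fun T hT => ?_
  rw [mem_powersetCard] at hT
  rw [seqSystem_comp, X.gLevel_eq_altSum hk f hj (hT.2 ▸ x.image_mem T)]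

lemma sum_superset_pow_mul_pow (ρ : ℝ) (T : Finset (Fin k)) :
    ∑ S ∈ univ.filter (T ⊆ ·), ρ ^ S.card * (1 - ρ) ^ (k - S.card) = ρ ^ T.card := by
  have h := sum_pow_mul_eq_add_pow ρ (1 - ρ) Tᶜ
  rw [add_sub_cancel, one_pow] at h
  have h2 : ∑ S ∈ univ.filter (T ⊆ ·), ρ ^ S.card * (1 - ρ) ^ (k - S.card) =
      ∑ R ∈ Tᶜ.powerset, ρ ^ T.card * (ρ ^ R.card * (1 - ρ) ^ (Tᶜ.card - R.card)) := by
    refine sum_bij' (fun S _ => S \ T) (fun R _ => T ∪ R) ?_ ?_ ?_ ?_ ?_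
    · intro S _
      rw [mem_powerset]
      exact fun v hv => mem_compl.2 (mem_sdiff.1 hv).2
    · intro R _
      simp
    · intro S hS
      exact union_sdiff_of_subset (mem_filter.1 hS).2
    · intro R hR
      rw [mem_powerset, subset_compl_iff_disjoint_right] at hR
      exact union_sdiff_cancel_left hR.symm
    · intro S hS
      have hTS := (mem_filter.1 hS).2
      have hle := card_le_card hTS
      rw [card_sdiff_of_subset hTS, card_compl, Fintype.card_fin, ← mul_assoc, ← pow_add,
        Nat.add_sub_cancel' hle]
      congr 2
      omega
  rw [h2, ← mul_sum, h, mul_one]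

lemma noiseOp_image (hk : k ≤ d) (f : Cf n) (ρ : ℝ) (x : X.Seq k) :
    noiseOp X k ρ f (univ.image x.1) = (∑ T, ρ ^ T.card •
      (X.seqSystem hk hγ hX).comp (fun y => f (univ.image y.1)) T) x := by
  set F : Finset (Fin k) → ℝ := fun S => linkMean X k (S.image x.1) f with hF
  have h1 : noiseOp X k ρ f (univ.image x.1) =
      ∑ S : Finset (Fin k), ρ ^ S.card * (1 - ρ) ^ (k - S.card) * F S := by
    rw [noiseOp, Finset.sum_apply, ← powerset_univ, sum_powerset, card_univ, Fintype.card_fin,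
      ← sum_range_reflect]
    refine sum_congr rfl fun i hi => ?_
    rw [mem_range] at hi
    obtain ⟨m, rfl⟩ : ∃ m, k = i + m := ⟨k - i, by omega⟩
    have e1 : i + m + 1 - 1 - i = m := by omega
    have e2 : i + m - m = i := by omega
    rw [e1, e2, Pi.smul_apply, smul_eq_mul, Nat.choose_symm_add.symm]
    have h2 := X.choose_mul_Uc (Dc X (i + m) m f) i m x.2
    rw [sum_powersetCard_image x.injective] at h2
    rw [mul_assoc (Nat.cast _), mul_right_comm, h2, sum_mul]
    refine sum_congr rfl fun T hT => ?_
    rw [mem_powersetCard] at hT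
    have hmem := x.image_mem T
    rw [hT.2] at hmem
    rw [hT.2, Nat.add_sub_cancel_left, X.Dc_eq_linkMean hk f (by omega) (by rwa [e2]), hF]
    ring
  have h2 : ∀ S, F S = ∑ T, if T ⊆ S then altSum F T else 0 := by
    intro S
    rw [← sum_filter, ← sum_altSum F S]
    refine sum_congr ?_ fun _ _ => rfl
    ext T
    simp
  rw [h1, Finset.sum_apply]
  simp_rw [h2, mul_sum]
  rw [sum_comm]
  refine sum_congr rfl fun T _ => ?_
  rw [Pi.smul_apply, smul_eq_mul, seqSystem_comp, altSum_image x.injective,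
    ← sum_superset_pow_mul_pow, sum_mul, sum_filter]
  refine sum_congr rfl fun S _ => ?_
  split_ifs <;> simp [hF]

end WSC

end Levels

/-- noise-operator form of hypercontractivity: there exist a
universal constant `a > 0` and `ρ₀ ∈ (0,1)` such that on any two-sided
`γ`-local-spectral expander with `γ ≤ 2^{−ak}`, any `(ε,i)`-pseudorandom `f ∈ C_k`
of degree `i` (its lifted Bottom-Up level functions `f_j^↑` vanish for `j > i`)
satisfies `‖T_{ρ₀} f‖₄⁴ ≤ ε·‖f‖₂²·‖f‖_∞²`. -/
theorem stmt18 : ∃ a ρ₀ : ℝ, 0 < a ∧ 0 < ρ₀ ∧ ρ₀ < 1 ∧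
    ∀ (n d : ℕ) (X : WSC n d) (γ : ℝ), 0 ≤ γ → IsLSE X γ →
    ∀ (k : ℕ), k ≤ d → γ ≤ (2:ℝ) ^ (-(a * (k:ℝ))) →
    ∀ (f : Cf n) (ε : ℝ), 0 ≤ ε → ∀ (i : ℕ), i ≤ k →
    Pseudorandom X k ε i f →
    (∀ j, i < j → j ≤ k → ∀ τ ∈ X.faces k, fLevel X k f j τ = 0) →
    EE X k (fun τ => (noiseOp X k ρ₀ f τ)^4) ≤
      ε * ip X k f f * (normInf X k f)^2 := by
  refine ⟨12, 1 / 64, by norm_num, by norm_num, by norm_num, ?_⟩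
  intro n d X γ _ hX k hk hγ f ε hε i hi hf hdeg
  have hpow : (2 : ℝ) ^ (-(12 * (k : ℝ))) = (1 / 4096) ^ k := by
    rw [Real.rpow_neg (by norm_num), Real.rpow_mul (by norm_num), Real.rpow_natCast, one_div,
      inv_pow]
    norm_num
  rw [hpow] at hγ
  have hγ0 : (0 : ℝ) < (1 / 4096) ^ k := by positivity
  have hX' := hX.mono hγ
  have hle : ∀ τ ∈ X.faces k, |f τ| ≤ normInf X k f := fun τ hτ =>
    le_ciSup (f := fun σ : {σ // σ ∈ X.faces k} => |f σ.1|) (Set.finite_range _).bddAbove ⟨τ, hτ⟩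
  have hattain : ∃ τ ∈ X.faces k, |f τ| = normInf X k f := by
    obtain ⟨σ, hσ⟩ := X.faces_nonempty hk
    have : Nonempty {σ // σ ∈ X.faces k} := ⟨⟨σ, hσ⟩⟩
    obtain ⟨τ, hτ⟩ := exists_eq_ciSup_of_finite (f := fun σ : {σ // σ ∈ X.faces k} => |f σ.1|)
    exact ⟨τ.1, τ.2, hτ⟩
  have key := (X.seqSystem hk hγ0 hX').noise_pow_four_le (f := fun y => f (univ.image y.1))
    (M := normInf X k f) (i := i) rfl hε (fun x => hle _ x.2) ?_ hi ?_ ?_ ?_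
  · have hE := WSC.seqSystem_E hγ0 hX' hk
    have e1 : ((∑ T, (1 / 64 : ℝ) ^ T.card •
        (X.seqSystem hk hγ0 hX').comp (fun y => f (univ.image y.1)) T) ^ 4) =
        fun y => noiseOp X k (1 / 64) f (univ.image y.1) ^ 4 := by
      ext y
      rw [Pi.pow_apply, WSC.noiseOp_image hγ0 hX' hk]
    have e2 : EE X k (fun σ => f σ ^ 2) = ip X k f f :=
      sum_congr rfl fun σ _ => by ring
    rwa [e1, hE fun σ => noiseOp X k (1 / 64) f σ ^ 4,
      show (fun y : X.Seq k => f (univ.image y.1)) ^ 2 = fun y => f (univ.image y.1) ^ 2 from rfl,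
      hE fun σ => f σ ^ 2, e2] at key
  · obtain ⟨τ, hτ, h⟩ := hattain
    obtain ⟨x, rfl⟩ := WSC.exists_seq hτ
    exact ⟨x, h⟩
  · intro S hS x
    rw [WSC.seqSystem_P]
    exact (hf _ (hS ▸ x.image_mem S)).1
  · intro S hS x
    rw [show (fun y : X.Seq k => f (univ.image y.1)) ^ 2 = fun y => f (univ.image y.1) ^ 2 from rfl,
      WSC.seqSystem_P hγ0 hX' hk fun σ => f σ ^ 2]
    have h := (hf _ (hS ▸ x.image_mem S)).2
    have e : linkIp X k (S.image x.1) f f = linkMean X k (S.image x.1) fun σ => f σ ^ 2 := by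
      rw [linkIp, linkMean]
      congr 1
      exact sum_congr rfl fun σ _ => by ring
    rwa [e] at h
  · intro j hij hjk
    ext x
    rw [Finset.sum_apply, ← WSC.fLevel_image hγ0 hX' hk f hjk x, Pi.zero_apply]
    exact hdeg j hij hjk _ x.2
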